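/- arXiv:2401.05387 — 2 statements merged into one kernel-verified Lean document; each statement's English description precedes it below -/
import Mathlib

section
/- Let T>0 and let f,g:[0,T]×ℝ⁴→ℝ be continuous. Suppose (α₁,α₂) and (β₁,β₂) are, respectively, lower and upper solutions of the periodic problem (OP),(PBC), that f,g satisfy a Nagumo-type condition relative to the intervals [α₁⁰(t),β₁⁰(t)] and [α₂⁰(t),β₂⁰(t)] for all t∈[0,T], that f(t,z₀,w₀,z₁,w₁) is non-increasing in w₀ (for each fixed t,z₀,w₁ and z₁ lying between min{min_t α₁'(t),min_t β₁'(t)} and max{max_t α₁'(t),max_t β₁'(t)}), and that g(t,z₀,w₀,z₁,w₁) is non-increasing in z₀ (for each fixed t,w₀,z₁ and w₁ lying between min{min_t α₂'(t),min_t β₂'(t)} and max{max_t α₂'(t),max_t β₂'(t)}). Then there exists at least one pair (z,w)∈(C²[0,T])² solving (OP),(PBC) and, moreover, α₁⁰(t)≤z(t)≤β₁⁰(t) and α₂⁰(t)≤w(t)≤β₂⁰(t) for all t∈[0,T]. -/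
/-- Sup norm of `α` on `[0,T]`: `‖α‖ = max_{t ∈ [0,T]} |α(t)|`. -/
noncomputable def supNorm (T : ℝ) (α : ℝ → ℝ) : ℝ :=
  sSup ((fun t => |α t|) '' Set.Icc 0 T)

/-- The shift `α⁰ := α − ‖α‖` used for lower solutions. -/
noncomputable def lowShift (T : ℝ) (α : ℝ → ℝ) : ℝ → ℝ :=
  fun t => α t - supNorm T α

/-- The shift `β⁰ := β + ‖β‖` used for upper solutions. -/
noncomputable def upShift (T : ℝ) (β : ℝ → ℝ) : ℝ → ℝ :=
  fun t => β t + supNorm T β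

/-- Periodic boundary conditions on `[0,T]`. -/
def PBC (T : ℝ) (z w : ℝ → ℝ) : Prop :=
  z 0 = z T ∧ deriv z 0 = deriv z T ∧ w 0 = w T ∧ deriv w 0 = deriv w T

/-- `(α₁, α₂)` is a lower solution of the periodic problem. -/
noncomputable def IsLowerSolution (T : ℝ) (f g : ℝ → ℝ → ℝ → ℝ → ℝ → ℝ)
    (α₁ α₂ : ℝ → ℝ) : Prop :=
  ContDiff ℝ 2 α₁ ∧ ContDiff ℝ 2 α₂ ∧
  (∀ t ∈ Set.Icc 0 T, ∀ w₁ : ℝ,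
    f t (lowShift T α₁ t) (lowShift T α₂ t) (deriv α₁ t) w₁ ≤ deriv (deriv α₁) t) ∧
  (∀ t ∈ Set.Icc 0 T, ∀ z₁ : ℝ,
    g t (lowShift T α₁ t) (lowShift T α₂ t) z₁ (deriv α₂ t) ≤ deriv (deriv α₂) t) ∧
  α₁ 0 = α₁ T ∧ α₂ 0 = α₂ T ∧
  deriv α₁ T ≤ deriv α₁ 0 ∧ deriv α₂ T ≤ deriv α₂ 0

/-- `(β₁, β₂)` is an upper solution of the periodic problem. -/
noncomputable def IsUpperSolution (T : ℝ) (f g : ℝ → ℝ → ℝ → ℝ → ℝ → ℝ)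
    (β₁ β₂ : ℝ → ℝ) : Prop :=
  ContDiff ℝ 2 β₁ ∧ ContDiff ℝ 2 β₂ ∧
  (∀ t ∈ Set.Icc 0 T, ∀ w₁ : ℝ,
    deriv (deriv β₁) t ≤ f t (upShift T β₁ t) (upShift T β₂ t) (deriv β₁ t) w₁) ∧
  (∀ t ∈ Set.Icc 0 T, ∀ z₁ : ℝ,
    deriv (deriv β₂) t ≤ g t (upShift T β₁ t) (upShift T β₂ t) z₁ (deriv β₂ t)) ∧
  β₁ 0 = β₁ T ∧ β₂ 0 = β₂ T ∧
  deriv β₁ 0 ≤ deriv β₁ T ∧ deriv β₂ 0 ≤ deriv β₂ T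

/-- The Nagumo-type condition for `f, g` relative to the intervals
`[γ₁(t), Γ₁(t)]` and `[γ₂(t), Γ₂(t)]`, with Nagumo functions `φ, ψ`. -/
def NagumoCondition (T : ℝ) (f g : ℝ → ℝ → ℝ → ℝ → ℝ → ℝ)
    (γ₁ Γ₁ γ₂ Γ₂ : ℝ → ℝ) (φ ψ : ℝ → ℝ) : Prop :=
  ContinuousOn φ (Set.Ici 0) ∧ ContinuousOn ψ (Set.Ici 0) ∧
  (∀ s ∈ Set.Ici (0:ℝ), 0 < φ s) ∧ (∀ s ∈ Set.Ici (0:ℝ), 0 < ψ s) ∧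
  (∫⁻ s in Set.Ici (0:ℝ), ENNReal.ofReal (1 / φ s)) = ⊤ ∧
  (∫⁻ s in Set.Ici (0:ℝ), ENNReal.ofReal (1 / ψ s)) = ⊤ ∧
  (∀ t ∈ Set.Icc 0 T, ∀ z₀ w₀ z₁ w₁ : ℝ,
    γ₁ t ≤ z₀ → z₀ ≤ Γ₁ t → γ₂ t ≤ w₀ → w₀ ≤ Γ₂ t →
    |f t z₀ w₀ z₁ w₁| ≤ φ |z₁| ∧ |g t z₀ w₀ z₁ w₁| ≤ ψ |w₁|)

section AuxPart
open MeasureTheory Metric Set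

/-- `∫ det(1 + tA)` is a polynomial in `t`. -/
lemma aux_det_poly {n : ℕ} (A : EuclideanSpace ℝ (Fin n) → EuclideanSpace ℝ (Fin n) →L[ℝ] EuclideanSpace ℝ (Fin n))
    (hA : ContinuousOn A (closedBall 0 1)) :
    ∃ q : Polynomial ℝ, ∀ t : ℝ, q.eval t =
      ∫ x in ball (0 : EuclideanSpace ℝ (Fin n)) 1,
        (ContinuousLinearMap.id ℝ (EuclideanSpace ℝ (Fin n)) + t • A x).det := by
  classical
  let b := (EuclideanSpace.basisFun (Fin n) ℝ).toBasis
  let M : EuclideanSpace ℝ (Fin n) → Matrix (Fin n) (Fin n) ℝ := fun x =>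
    LinearMap.toMatrix b b (A x : EuclideanSpace ℝ (Fin n) →ₗ[ℝ] EuclideanSpace ℝ (Fin n))
  have hM : ∀ i j, ContinuousOn (fun x => M x i j) (closedBall 0 1) := by
    intro i j
    have : ∀ x, M x i j = (A x (EuclideanSpace.basisFun (Fin n) ℝ j)) i := by
      intro x
      simp [M, b, LinearMap.toMatrix_apply]
    simp_rw [this]
    have h1 : ContinuousOn (fun x => A x (EuclideanSpace.basisFun (Fin n) ℝ j)) (closedBall 0 1) :=
      hA.clm_apply continuousOn_const
    exact (EuclideanSpace.proj (𝕜 := ℝ) i).continuous.comp_continuousOn h1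
  have hdet : ∀ t x, (ContinuousLinearMap.id ℝ (EuclideanSpace ℝ (Fin n)) + t • A x).det =
      ∑ σ : Equiv.Perm (Fin n), ∑ s ∈ (Finset.univ : Finset (Fin n)).powerset,
        t ^ ((Finset.univ \ s).card) * (((Equiv.Perm.sign σ : ℤ) : ℝ) *
          ((∏ i ∈ s, (1 : Matrix (Fin n) (Fin n) ℝ) (σ i) i) * ∏ i ∈ Finset.univ \ s, M x (σ i) i)) := by
    intro t x
    have h1 : (ContinuousLinearMap.id ℝ (EuclideanSpace ℝ (Fin n)) + t • A x).det =
        (1 + t • M x).det := by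
      rw [ContinuousLinearMap.det, ← LinearMap.det_toMatrix b]
      congr 1
      simp [M]
    rw [h1, Matrix.det_apply]
    refine Finset.sum_congr rfl fun σ _ => ?_
    simp only [Matrix.add_apply, Matrix.smul_apply, smul_eq_mul]
    rw [Finset.prod_add, Finset.smul_sum]
    refine Finset.sum_congr rfl fun s _ => ?_
    rw [Finset.prod_mul_distrib, Finset.prod_const, Units.smul_def, zsmul_eq_mul]
    ring
  have hInt : ∀ (σ : Equiv.Perm (Fin n)) (s : Finset (Fin n)) , IntegrableOn (fun x =>
      (((Equiv.Perm.sign σ : ℤ) : ℝ) *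
          ((∏ i ∈ s, (1 : Matrix (Fin n) (Fin n) ℝ) (σ i) i) * ∏ i ∈ Finset.univ \ s, M x (σ i) i)))
          (ball (0 : EuclideanSpace ℝ (Fin n)) 1) := by
    intro σ s
    refine IntegrableOn.mono_set (t := closedBall 0 1) ?_ ball_subset_closedBall
    refine ContinuousOn.integrableOn_compact (isCompact_closedBall _ _) ?_
    refine continuousOn_const.mul (continuousOn_const.mul ?_)
    exact continuousOn_finsetProd _ fun i _ => hM _ _
  refine ⟨∑ σ : Equiv.Perm (Fin n), ∑ s ∈ (Finset.univ : Finset (Fin n)).powerset,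
    Polynomial.X ^ ((Finset.univ \ s).card) * Polynomial.C (∫ x in ball (0 : EuclideanSpace ℝ (Fin n)) 1,
      (((Equiv.Perm.sign σ : ℤ) : ℝ) *
          ((∏ i ∈ s, (1 : Matrix (Fin n) (Fin n) ℝ) (σ i) i) * ∏ i ∈ Finset.univ \ s, M x (σ i) i))), ?_⟩
  intro t
  simp_rw [hdet]
  rw [integral_finsetSum]
  · rw [Polynomial.eval_finsetSum]
    refine Finset.sum_congr rfl fun σ _ => ?_
    rw [integral_finsetSum]
    · rw [Polynomial.eval_finsetSum]
      refine Finset.sum_congr rfl fun s _ => ?_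
      rw [Polynomial.eval_mul, Polynomial.eval_pow, Polynomial.eval_X, Polynomial.eval_C,
        ← integral_const_mul]
    · intro s _
      exact (hInt σ s).const_mul _
  · intro σ _
    refine integrable_finsetSum _ fun s _ => (hInt σ s).const_mul _

/-- There is no `C¹` retraction of the ball onto the sphere. -/
lemma aux_no_retract {n : ℕ} (h : EuclideanSpace ℝ (Fin n) → EuclideanSpace ℝ (Fin n))
    (hh : ∀ x ∈ closedBall (0 : EuclideanSpace ℝ (Fin n)) 1, ContDiffAt ℝ 1 h x)
    (h0 : ∀ x, ‖x‖ = 1 → h x = 0)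
    (h1 : ∀ x ∈ ball (0 : EuclideanSpace ℝ (Fin n)) 1, ‖x + h x‖ = 1) : False := by
  classical
  have hA : ContinuousOn (fderiv ℝ h) (closedBall 0 1) := fun x hx =>
    ((hh x hx).fderiv_right (m := 0) (by simp)).continuousAt.continuousWithinAt
  obtain ⟨C, hC⟩ := (isCompact_closedBall (0 : EuclideanSpace ℝ (Fin n)) 1).exists_bound_of_continuousOn hA
  set K : NNReal := Real.toNNReal C with hK
  have hlip : LipschitzOnWith K h (closedBall 0 1) := by
    refine Convex.lipschitzOnWith_of_nnnorm_fderiv_le (𝕜 := ℝ)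
      (fun x hx => (hh x hx).differentiableAt (by simp)) ?_ (convex_closedBall _ _)
    intro x hx
    rw [← NNReal.coe_le_coe]
    exact (hC x hx).trans (Real.le_coe_toNNReal C)
  let H : EuclideanSpace ℝ (Fin n) → EuclideanSpace ℝ (Fin n) := fun x => if ‖x‖ < 1 then h x else 0
  have Hin : ∀ x, ‖x‖ ≤ 1 → H x = h x := by
    intro x hx
    rcases hx.lt_or_eq with h2 | h2
    · simp [H, h2]
    · simp [H, h2, h0 x h2]
  have Hout : ∀ x, 1 ≤ ‖x‖ → H x = 0 := by
    intro x hx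
    simp [H, not_lt.2 hx]
  have key : ∀ x y, ‖x‖ ≤ 1 → 1 ≤ ‖y‖ → ‖h x‖ ≤ K * ‖x - y‖ := by
    intro x y hx hy
    obtain ⟨s, hs, hs1⟩ : ∃ s ∈ Icc (0:ℝ) 1, ‖x + s • (y - x)‖ = 1 := by
      have := intermediate_value_Icc (f := fun s : ℝ => ‖x + s • (y - x)‖) zero_le_one
        (by fun_prop)
      have h3 := this (show (1:ℝ) ∈ _ by simp [hx, hy])
      simpa using h3
    have h4 := hlip.norm_sub_le (mem_closedBall_zero_iff.2 hx) (mem_closedBall_zero_iff.2 hs1.le)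
    rw [h0 _ hs1, sub_zero] at h4
    refine h4.trans ?_
    gcongr
    have : x - (x + s • (y - x)) = s • (x - y) := by
      rw [smul_sub, smul_sub]; abel
    rw [this, norm_smul, Real.norm_of_nonneg hs.1]
    exact mul_le_of_le_one_left (norm_nonneg _) hs.2
  have HL : ∀ x y, ‖H x - H y‖ ≤ K * ‖x - y‖ := by
    intro x y
    rcases le_total ‖x‖ 1 with hx | hx <;> rcases le_total ‖y‖ 1 with hy | hy
    · rw [Hin x hx, Hin y hy]
      exact hlip.norm_sub_le (mem_closedBall_zero_iff.2 hx) (mem_closedBall_zero_iff.2 hy)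
    · rw [Hin x hx, Hout y hy, sub_zero]
      exact key x y hx hy
    · rw [Hout x hx, Hin y hy, zero_sub, norm_neg, norm_sub_rev]
      exact key y x hy hx
    · rw [Hout x hx, Hout y hy]
      simp; positivity
  -- the set of good small t
  have hdetpos : ∃ ε > 0, ∀ L : EuclideanSpace ℝ (Fin n) →L[ℝ] EuclideanSpace ℝ (Fin n),
      ‖L - ContinuousLinearMap.id ℝ _‖ < ε → 0 < L.det := by
    have h2 : ContinuousAt (fun L : EuclideanSpace ℝ (Fin n) →L[ℝ] EuclideanSpace ℝ (Fin n) => L.det)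
      (ContinuousLinearMap.id ℝ _) := ContinuousLinearMap.continuous_det.continuousAt
    have h3 := h2.eventually (lt_mem_nhds (show (0:ℝ) < _ by simp [ContinuousLinearMap.det]))
    obtain ⟨ε, hε, h4⟩ := Metric.eventually_nhds_iff.1 h3
    exact ⟨ε, hε, fun L hL => h4 (by rwa [dist_eq_norm])⟩
  obtain ⟨ε, hε, hdet⟩ := hdetpos
  obtain ⟨q, hq⟩ := aux_det_poly _ hA
  set V := volume.real (ball (0 : EuclideanSpace ℝ (Fin n)) 1) with hV
  have hVpos : 0 < V := by
    rw [hV, measureReal_def]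
    exact ENNReal.toReal_pos (measure_ball_pos volume _ one_pos).ne' measure_ball_lt_top.ne
  have hsmall : ∀ t : ℝ, 0 ≤ t → t * K < 1 → t * K < ε → q.eval t = V := by
    intro t ht ht1 ht2
    let G : EuclideanSpace ℝ (Fin n) → EuclideanSpace ℝ (Fin n) := fun x => x + t • H x
    have hG : ApproximatesLinearOn G
        ((ContinuousLinearEquiv.refl ℝ (EuclideanSpace ℝ (Fin n)) : _ ≃L[ℝ] _) :
          EuclideanSpace ℝ (Fin n) →L[ℝ] EuclideanSpace ℝ (Fin n)) univ (Real.toNNReal t * K) := by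
      intro x _ y _
      have : G x - G y - (x - y) = t • (H x - H y) := by
        simp only [G, smul_sub]; abel
      simp only [ContinuousLinearEquiv.coe_refl, ContinuousLinearMap.coe_id', id_eq]
      rw [this, norm_smul, Real.norm_of_nonneg ht, NNReal.coe_mul, Real.coe_toNNReal _ ht, mul_assoc]
      gcongr
      exact HL x y
    have hc : Subsingleton (EuclideanSpace ℝ (Fin n)) ∨ Real.toNNReal t * K <
        ‖(((ContinuousLinearEquiv.refl ℝ (EuclideanSpace ℝ (Fin n))).symm : _ ≃L[ℝ] _) :
          EuclideanSpace ℝ (Fin n) →L[ℝ] EuclideanSpace ℝ (Fin n))‖₊⁻¹ := by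
      rcases subsingleton_or_nontrivial (EuclideanSpace ℝ (Fin n)) with h | h
      · exact Or.inl h
      · right
        have : ‖(((ContinuousLinearEquiv.refl ℝ (EuclideanSpace ℝ (Fin n))).symm : _ ≃L[ℝ] _) :
          EuclideanSpace ℝ (Fin n) →L[ℝ] EuclideanSpace ℝ (Fin n))‖₊ = 1 := by
          rw [← NNReal.coe_inj]
          simp
        rw [this, inv_one, ← NNReal.coe_lt_coe, NNReal.coe_mul, Real.coe_toNNReal _ ht]
        exact ht1
    have hinj : Function.Injective G := injOn_univ.1 (hG.injOn hc)
    have hsurj : Function.Surjective G := hG.surjective hc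
    have hGout : ∀ x, 1 ≤ ‖x‖ → G x = x := by
      intro x hx
      simp [G, Hout x hx]
    have himg : G '' ball 0 1 = ball 0 1 := by
      apply Subset.antisymm
      · rintro _ ⟨x, hx, rfl⟩
        by_contra hcon
        rw [mem_ball_zero_iff, not_lt] at hcon
        have := hinj (hGout _ hcon)
        rw [this, ← not_lt] at hcon
        exact hcon (mem_ball_zero_iff.1 hx)
      · intro y hy
        obtain ⟨x, rfl⟩ := hsurj y
        refine ⟨x, ?_, rfl⟩
        by_contra hcon
        rw [mem_ball_zero_iff, not_lt] at hcon
        rw [hGout _ hcon, mem_ball_zero_iff] at hy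
        linarith
    have hder : ∀ x ∈ ball (0 : EuclideanSpace ℝ (Fin n)) 1, HasFDerivWithinAt G
        (ContinuousLinearMap.id ℝ _ + t • fderiv ℝ h x) (ball 0 1) x := by
      intro x hx
      have h2 : HasFDerivAt (fun x => x + t • h x) (ContinuousLinearMap.id ℝ _ + t • fderiv ℝ h x) x :=
        (hasFDerivAt_id x).add
          ((((hh x (ball_subset_closedBall hx)).differentiableAt (by simp)).hasFDerivAt).const_smul t)
      refine h2.hasFDerivWithinAt.congr (fun y hy => ?_) ?_
      · simp [G, Hin y (mem_ball_zero_iff.1 hy).le]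
      · simp [G, Hin x (mem_ball_zero_iff.1 hx).le]
    have hcv := integral_image_eq_integral_abs_det_fderiv_smul volume measurableSet_ball hder
      hinj.injOn (fun _ => (1:ℝ))
    rw [himg] at hcv
    rw [hq t]
    have h5 : V = ∫ x in ball (0 : EuclideanSpace ℝ (Fin n)) 1, (1:ℝ) := by
      simp [hV]
    rw [h5, hcv]
    refine setIntegral_congr_fun measurableSet_ball fun x hx => ?_
    have h6 : 0 < (ContinuousLinearMap.id ℝ (EuclideanSpace ℝ (Fin n)) + t • fderiv ℝ h x).det := by
      apply hdet
      rw [add_sub_cancel_left, norm_smul, Real.norm_of_nonneg ht]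
      refine lt_of_le_of_lt ?_ ht2
      gcongr
      exact (hC x (ball_subset_closedBall hx)).trans (Real.le_coe_toNNReal C)
    simp [abs_of_pos h6]
  have hqV : q = Polynomial.C V := by
    apply Polynomial.eq_of_infinite_eval_eq
    set δ := min 1 ε / (2 * (K + 1)) with hδ
    have hm : 0 < min 1 ε := lt_min one_pos hε
    have hδpos : 0 < δ := by positivity
    refine (Set.Icc_infinite hδpos).mono ?_
    intro t ht
    have h7 : t * K < min 1 ε := by
      calc t * K ≤ δ * (K + 1) := by
            have := ht.2; gcongr; linarith
        _ = min 1 ε / 2 := by rw [hδ]; field_simp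
        _ < min 1 ε := by linarith
    show q.eval t = (Polynomial.C V).eval t
    rw [Polynomial.eval_C]
    exact hsmall t ht.1 (h7.trans_le (min_le_left _ _)) (h7.trans_le (min_le_right _ _))
  have h8 := hq 1
  rw [hqV, Polynomial.eval_C, setIntegral_congr_fun (g := fun _ => (0:ℝ)) measurableSet_ball] at h8
  · simp at h8; exact hVpos.ne' h8
  intro x hx
  show (ContinuousLinearMap.id ℝ (EuclideanSpace ℝ (Fin n)) + (1:ℝ) • fderiv ℝ h x).det = 0
  set L := ContinuousLinearMap.id ℝ (EuclideanSpace ℝ (Fin n)) + (1:ℝ) • fderiv ℝ h x with hL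
  have hd : HasFDerivAt (fun x => x + h x) L x := by
    rw [hL, one_smul]
    exact (hasFDerivAt_id x).add
          (((hh x (ball_subset_closedBall hx)).differentiableAt (by simp)).hasFDerivAt)
  have hd2 := hd.inner ℝ hd
  have hconst : (fun y => inner ℝ (y + h y) (y + h y)) =ᶠ[nhds x] fun _ => (1:ℝ) := by
    filter_upwards [isOpen_ball.mem_nhds hx] with y hy
    rw [real_inner_self_eq_norm_sq, h1 y hy]; norm_num
  have hd3 := (hd2.congr_of_eventuallyEq hconst.symm).unique (hasFDerivAt_const (1:ℝ) x)
  have horth : ∀ v, inner ℝ (x + h x) (L v) = 0 := by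
    intro v
    have := congrArg (fun l => l v) hd3
    simp [fderivInnerCLM_apply] at this
    rw [real_inner_comm (x + h x) (L v)] at this
    linarith
  by_contra hne
  have hu : IsUnit (LinearMap.det (L : EuclideanSpace ℝ (Fin n) →ₗ[ℝ] EuclideanSpace ℝ (Fin n))) :=
    isUnit_iff_ne_zero.2 hne
  have hu2 := (LinearMap.isUnit_iff_isUnit_det _).2 hu
  have hr := (LinearMap.isUnit_iff_range_eq_top _).1 hu2
  obtain ⟨v, hv⟩ := LinearMap.range_eq_top.1 hr (x + h x)
  have h9 := horth v
  rw [ContinuousLinearMap.coe_coe] at hv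
  rw [hv, real_inner_self_eq_norm_sq, h1 x hx] at h9
  norm_num at h9


/-- Brouwer for smooth maps into the open ball. -/
lemma aux_brouwer_smooth {n : ℕ} (p : EuclideanSpace ℝ (Fin n) → EuclideanSpace ℝ (Fin n))
    (hp : ContDiff ℝ 1 p) (hp1 : ∀ x, ‖p x‖ < 1) : ∃ x, p x = x := by
  by_contra hcon
  push Not at hcon
  let u : EuclideanSpace ℝ (Fin n) → EuclideanSpace ℝ (Fin n) := fun x => x - p x
  have hu0 : ∀ x, 0 < ‖u x‖ ^ 2 := fun x => by
    have : u x ≠ 0 := sub_ne_zero.2 (hcon x).symm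
    positivity
  have hu : ContDiff ℝ 1 u := contDiff_id.sub hp
  let D : EuclideanSpace ℝ (Fin n) → ℝ := fun x =>
    (inner ℝ x (u x)) ^ 2 + ‖u x‖ ^ 2 * (1 - ‖x‖ ^ 2)
  have hDc : ContDiff ℝ 1 D :=
    ((contDiff_id.inner ℝ hu).pow 2).add ((hu.norm_sq ℝ).mul (contDiff_const.sub (contDiff_id.norm_sq ℝ)))
  have hxu : ∀ x, ‖x‖ = 1 → 0 < inner ℝ x (u x) := by
    intro x hx
    have h2 : inner ℝ x (u x) = ‖x‖ ^ 2 - inner ℝ x (p x) := by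
      simp only [u, inner_sub_right, real_inner_self_eq_norm_sq]
    have h3 := real_inner_le_norm x (p x)
    have h4 := hp1 x
    rw [h2, hx]; rw [hx] at h3; linarith
  have hD : ∀ x, ‖x‖ ≤ 1 → 0 < D x := by
    intro x hx
    rcases hx.lt_or_eq with h2 | h2
    · have h3 : 0 < 1 - ‖x‖ ^ 2 := by nlinarith [norm_nonneg x]
      have := mul_pos (hu0 x) h3
      have := sq_nonneg (inner ℝ x (u x))
      simp only [D]; linarith
    · have := hxu x h2
      simp only [D, h2]
      have := pow_pos this 2
      linarith
  let l : EuclideanSpace ℝ (Fin n) → ℝ := fun x =>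
    (-(inner ℝ x (u x)) + Real.sqrt (D x)) / ‖u x‖ ^ 2
  refine aux_no_retract (fun x => l x • u x) ?_ ?_ ?_
  · intro x hx
    have hl : ContDiffAt ℝ 1 l x := by
      refine ContDiffAt.div ?_ (hu.norm_sq ℝ).contDiffAt (hu0 x).ne'
      refine (contDiff_id.inner ℝ hu).neg.contDiffAt.add ?_
      exact hDc.contDiffAt.sqrt (hD x (mem_closedBall_zero_iff.1 hx)).ne'
    exact hl.smul hu.contDiffAt
  · intro x hx
    have h2 : l x = 0 := by
      have : D x = (inner ℝ x (u x)) ^ 2 := by simp [D, hx]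
      simp only [l, this, Real.sqrt_sq (hxu x hx).le]
      simp
    simp [h2]
  · intro x hx
    have h2 := hD x (mem_ball_zero_iff.1 hx).le
    have h3 : ‖x + l x • u x‖ ^ 2 = 1 := by
      rw [norm_add_sq_real, inner_smul_right, norm_smul, mul_pow, Real.norm_eq_abs, sq_abs]
      have h4 : l x * ‖u x‖ ^ 2 = -(inner ℝ x (u x)) + Real.sqrt (D x) := by
        simp only [l]; rw [div_mul_cancel₀ _ (hu0 x).ne']
      have h5 : Real.sqrt (D x) ^ 2 = D x := Real.sq_sqrt h2.le
      have h6 : (l x * ‖u x‖ ^ 2 + inner ℝ x (u x)) ^ 2 = D x := by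
        rw [h4, neg_add_cancel_comm, h5]
      have h7 : ‖u x‖ ^ 2 * (‖x‖ ^ 2 + 2 * (l x * inner ℝ x (u x)) + l x ^ 2 * ‖u x‖ ^ 2) = ‖u x‖ ^ 2 * 1 := by
        simp only [D] at h6
        linarith
      exact mul_left_cancel₀ (hu0 x).ne' h7
    have := norm_nonneg (x + l x • u x)
    nlinarith

/-- Approximate Brouwer. -/
lemma aux_brouwer_approx {n : ℕ} (p : EuclideanSpace ℝ (Fin n) → EuclideanSpace ℝ (Fin n))
    (hp : Continuous p) (hp1 : ∀ x, ‖p x‖ ≤ 1) (ε : ℝ) (hε : 0 < ε) : ∃ x, ‖p x - x‖ ≤ ε := by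
  set δ := min (1/2) (ε / 2) with hδ
  have hδ0 : 0 < δ := by positivity
  have hδ1 : δ ≤ 1/2 := min_le_left _ _
  have hδ2 : δ ≤ ε / 2 := min_le_right _ _
  obtain ⟨q, hq, hqd, -⟩ := (hp.const_smul (1 - δ)).exists_contDiff_approx 1
    (continuous_const (y := δ)) (fun _ => hδ0)
  have hq2 : ∀ x, ‖q x - p x‖ ≤ 2 * δ := by
    intro x
    have h1 := hqd x
    rw [dist_eq_norm, Pi.smul_apply] at h1
    have h2 : q x - p x = (q x - (1 - δ) • p x) - δ • p x := by
      rw [sub_smul, one_smul]; abel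
    rw [h2]
    have h3 : ‖δ • p x‖ ≤ δ := by
      rw [norm_smul, Real.norm_of_nonneg hδ0.le]
      exact mul_le_of_le_one_right hδ0.le (hp1 x)
    have := norm_sub_le (q x - (1 - δ) • p x) (δ • p x)
    linarith
  have hq1 : ∀ x, ‖q x‖ < 1 := by
    intro x
    have h1 := hqd x
    rw [dist_eq_norm, Pi.smul_apply] at h1
    have h3 : ‖(1 - δ) • p x‖ ≤ 1 - δ := by
      rw [norm_smul, Real.norm_of_nonneg (by linarith)]
      exact mul_le_of_le_one_right (by linarith) (hp1 x)
    have := norm_sub_norm_le (q x) ((1 - δ) • p x)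
    linarith
  obtain ⟨x, hx⟩ := aux_brouwer_smooth q (by exact_mod_cast hq) hq1
  refine ⟨x, ?_⟩
  have := hq2 x
  rw [hx, norm_sub_rev] at this
  linarith

/-- The Schauder fixed point theorem. -/
lemma aux_schauder {X : Type*} [NormedAddCommGroup X] [NormedSpace ℝ X] (Φ : X → X)
    (hΦ : Continuous Φ) (K : Set X) (hK : IsCompact K) (hΦK : ∀ x, Φ x ∈ K) : ∃ x, Φ x = x := by
  classical
  have happrox : ∀ ε > 0, ∃ x, ‖Φ x - x‖ ≤ ε := by
    intro ε hε
    obtain ⟨s, hsK, hsf, hcov⟩ := hK.finite_cover_balls (half_pos hε)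
    obtain ⟨R, hR0, hR⟩ : ∃ R > 0, ∀ y ∈ s, ‖y‖ ≤ R := by
      obtain ⟨R, hR⟩ := hK.isBounded.exists_norm_le
      exact ⟨max R 1, by positivity, fun y hy => (hR y (hsK hy)).trans (le_max_left _ _)⟩
    let n := hsf.toFinset.card
    let e : Fin n ≃ hsf.toFinset := hsf.toFinset.equivFin.symm
    let y : Fin n → X := fun i => (e i : X)
    have hy : ∀ i, y i ∈ s := fun i => hsf.mem_toFinset.1 (e i).2
    have hys : ∀ z ∈ s, ∃ i, y i = z := fun z hz => ⟨e.symm ⟨z, hsf.mem_toFinset.2 hz⟩, by simp [y]⟩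
    let m : Fin n → X → ℝ := fun i x => max 0 (ε / 2 - ‖Φ x - y i‖)
    have hm0 : ∀ i x, 0 ≤ m i x := fun i x => le_max_left _ _
    have hmc : ∀ i, Continuous (m i) := fun i => by fun_prop
    let S : X → ℝ := fun x => ∑ i, m i x
    have hSc : Continuous S := by fun_prop
    have hS : ∀ x, 0 < S x := by
      intro x
      obtain ⟨z, hz, hxz⟩ := mem_iUnion₂.1 (hcov (hΦK x))
      obtain ⟨i, rfl⟩ := hys z hz
      refine Finset.sum_pos' (fun i _ => hm0 i x) ⟨i, Finset.mem_univ _, ?_⟩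
      rw [mem_ball, dist_eq_norm] at hxz
      exact lt_max_of_lt_right (by linarith)
    let comb : EuclideanSpace ℝ (Fin n) → X := fun c => ∑ i, c i • y i
    have hcomb : Continuous comb := by fun_prop
    let p : EuclideanSpace ℝ (Fin n) → EuclideanSpace ℝ (Fin n) := fun c =>
      WithLp.toLp 2 (fun i => m i (comb c) / S (comb c))
    have hpc : Continuous p := by
      refine (PiLp.continuous_toLp 2 _).comp (continuous_pi fun i => ?_)
      exact ((hmc i).comp hcomb).div (hSc.comp hcomb) (fun c => (hS _).ne')
    have hpi : ∀ c i, p c i = m i (comb c) / S (comb c) := fun c i => rfl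
    have hp0 : ∀ c i, 0 ≤ p c i := fun c i => div_nonneg (hm0 _ _) (hS _).le
    have hpsum : ∀ c, ∑ i, p c i = 1 := by
      intro c
      simp_rw [hpi, ← Finset.sum_div]
      exact div_self (hS _).ne'
    have hp1 : ∀ c, ‖p c‖ ≤ 1 := by
      intro c
      have h2 : ‖p c‖ ^ 2 ≤ 1 := by
        rw [EuclideanSpace.norm_sq_eq]
        calc ∑ i, ‖p c i‖ ^ 2 ≤ ∑ i, p c i := by
              refine Finset.sum_le_sum fun i _ => ?_
              rw [Real.norm_of_nonneg (hp0 c i)]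
              have : p c i ≤ 1 := by
                rw [← hpsum c]
                exact Finset.single_le_sum (fun j _ => hp0 c j) (Finset.mem_univ i)
              nlinarith [hp0 c i]
          _ = 1 := hpsum c
      nlinarith [norm_nonneg (p c)]
    have hcl : ∀ c, ‖comb (p c) - Φ (comb c)‖ ≤ ε / 2 := by
      intro c
      have h2 : comb (p c) - Φ (comb c) = ∑ i, p c i • (y i - Φ (comb c)) := by
        simp only [smul_sub, Finset.sum_sub_distrib, ← Finset.sum_smul, hpsum, one_smul, comb]
      rw [h2]
      calc ‖∑ i, p c i • (y i - Φ (comb c))‖ ≤ ∑ i, p c i * (ε / 2) := by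
            refine norm_sum_le_of_le _ fun i _ => ?_
            rw [norm_smul, Real.norm_of_nonneg (hp0 c i)]
            by_cases h3 : ‖Φ (comb c) - y i‖ ≤ ε / 2
            · rw [norm_sub_rev]
              exact mul_le_mul_of_nonneg_left h3 (hp0 c i)
            · have : p c i = 0 := by
                rw [hpi]
                have : m i (comb c) = 0 := max_eq_left (by linarith)
                simp [this]
              simp [this]
        _ = ε / 2 := by rw [← Finset.sum_mul, hpsum, one_mul]
    have hRn : 0 < ε / (2 * (n * R + 1)) := by positivity
    obtain ⟨c, hc⟩ := aux_brouwer_approx p hpc hp1 _ hRn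
    refine ⟨comb c, ?_⟩
    have h4 : ‖comb (p c) - comb c‖ ≤ ε / 2 := by
      have h5 : comb (p c) - comb c = ∑ i, (p c - c) i • y i := by
        simp [comb, sub_smul, Finset.sum_sub_distrib]
      rw [h5]
      calc ‖∑ i, (p c - c) i • y i‖ ≤ ∑ i : Fin n, ε / (2 * (n * R + 1)) * R := by
            refine norm_sum_le_of_le _ fun i _ => ?_
            rw [norm_smul]
            have := (PiLp.norm_apply_le (p c - c) i).trans hc
            exact mul_le_mul this (hR _ (hy i)) (norm_nonneg _) hRn.le
        _ = (ε / 2) * ((n * R) / (n * R + 1)) := by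
            simp only [Finset.sum_const, Finset.card_univ, Fintype.card_fin, nsmul_eq_mul]
            have : (0:ℝ) < n * R + 1 := by positivity
            field_simp
        _ ≤ ε / 2 := by
            refine mul_le_of_le_one_right (by positivity) ?_
            rw [div_le_one (by positivity)]; linarith
    have h6 : Φ (comb c) - comb c = (comb (p c) - comb c) - (comb (p c) - Φ (comb c)) := by abel
    rw [h6]
    have := norm_sub_le (comb (p c) - comb c) (comb (p c) - Φ (comb c))
    have := hcl c
    linarith
  choose x hx using fun k : ℕ => happrox (1 / ((k:ℝ) + 1)) (by positivity)
  obtain ⟨a, -, φ, hφ, hlim⟩ := hK.tendsto_subseq (fun k => hΦK (x k))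
  have hd : Filter.Tendsto (fun k => Φ (x (φ k)) - x (φ k)) Filter.atTop (nhds 0) := by
    have h1 : Filter.Tendsto (fun k => Φ (x k) - x k) Filter.atTop (nhds 0) :=
      squeeze_zero_norm hx tendsto_one_div_add_atTop_nhds_zero_nat
    exact h1.comp hφ.tendsto_atTop
  have hxl : Filter.Tendsto (fun k => x (φ k)) Filter.atTop (nhds a) := by
    have := hlim.sub hd
    simpa using this
  exact ⟨a, tendsto_nhds_unique ((hΦ.tendsto a).comp hxl) hlim⟩


/-- The `T`-periodic solution of the linear equation with coefficient `a` and right side `h`. -/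
noncomputable def auxPer (T a : ℝ) (h : ℝ → ℝ) (t : ℝ) : ℝ :=
  Real.exp (a * t) * (Real.exp (a * T) / (1 - Real.exp (a * T)) *
    (∫ s in (0:ℝ)..T, Real.exp (-(a * s)) * h s) + ∫ s in (0:ℝ)..t, Real.exp (-(a * s)) * h s)

lemma auxPer_hasDerivAt (T a : ℝ) (h : ℝ → ℝ) (hh : Continuous h) (t : ℝ) :
    HasDerivAt (auxPer T a h) (a * auxPer T a h t + h t) t := by
  have h1 : HasDerivAt (fun t => ∫ s in (0:ℝ)..t, Real.exp (-(a * s)) * h s)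
      (Real.exp (-(a * t)) * h t) t :=
    Continuous.deriv_integral (fun s => Real.exp (-(a * s)) * h s) (by fun_prop) 0 t ▸
      (intervalIntegral.differentiable_integral_of_continuous (by fun_prop)).differentiableAt.hasDerivAt
  have h2 : HasDerivAt (fun t => Real.exp (a * t)) (Real.exp (a * t) * a) t := by
    simpa using ((hasDerivAt_id t).const_mul a).exp
  have h3 := h2.mul (h1.const_add (Real.exp (a * T) / (1 - Real.exp (a * T)) *
    (∫ s in (0:ℝ)..T, Real.exp (-(a * s)) * h s)))
  refine h3.congr_deriv ?_
  have h4 : Real.exp (a * t) * Real.exp (-(a * t)) = 1 := by rw [← Real.exp_add]; simp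
  simp only [auxPer]
  linear_combination h t * h4

lemma auxPer_periodic (T a : ℝ) (hT : 0 < T) (ha : a ≠ 0) (h : ℝ → ℝ) :
    auxPer T a h 0 = auxPer T a h T := by
  have h1 : 1 - Real.exp (a * T) ≠ 0 := by
    rw [sub_ne_zero, ne_comm, Ne, Real.exp_eq_one_iff]
    exact mul_ne_zero ha hT.ne'
  simp only [auxPer, mul_zero, Real.exp_zero, intervalIntegral.integral_same]
  field_simp
  ring

lemma auxPer_congr (T a : ℝ) (h k : ℝ → ℝ) (hk : ∀ t ∈ Icc 0 T, h t = k t)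
    (t : ℝ) (ht : t ∈ Icc 0 T) : auxPer T a h t = auxPer T a k t := by
  have h1 : ∀ t ∈ Icc 0 T, (∫ s in (0:ℝ)..t, Real.exp (-(a * s)) * h s) =
      ∫ s in (0:ℝ)..t, Real.exp (-(a * s)) * k s := by
    intro t ht
    refine intervalIntegral.integral_congr fun s hs => ?_
    rw [uIcc_of_le ht.1] at hs
    show _ * h s = _ * k s
    rw [hk s ⟨hs.1, hs.2.trans ht.2⟩]
  simp only [auxPer]
  rw [h1 t ht, h1 T ⟨ht.1.trans ht.2, le_rfl⟩]

lemma auxPer_sub (T a : ℝ) (h k : ℝ → ℝ) (hh : Continuous h) (hk : Continuous k) (t : ℝ) :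
    auxPer T a (fun s => h s - k s) t = auxPer T a h t - auxPer T a k t := by
  have h1 : ∀ t, (∫ s in (0:ℝ)..t, Real.exp (-(a * s)) * (h s - k s)) =
      (∫ s in (0:ℝ)..t, Real.exp (-(a * s)) * h s) - ∫ s in (0:ℝ)..t, Real.exp (-(a * s)) * k s := by
    intro t
    rw [← intervalIntegral.integral_sub]
    · simp_rw [mul_sub]
    · exact Continuous.intervalIntegrable (by fun_prop) _ _
    · exact Continuous.intervalIntegrable (by fun_prop) _ _
  simp only [auxPer, h1]
  ring

lemma auxPer_bound (T a : ℝ) (hT : 0 < T) : ∃ C : ℝ, 0 ≤ C ∧ ∀ (h : ℝ → ℝ) (M : ℝ), 0 ≤ M →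
    (∀ t ∈ Icc 0 T, |h t| ≤ M) → ∀ t ∈ Icc 0 T, |auxPer T a h t| ≤ C * M := by
  refine ⟨Real.exp (|a| * T) * (|Real.exp (a * T) / (1 - Real.exp (a * T))| *
    (Real.exp (|a| * T) * T) + Real.exp (|a| * T) * T), by positivity, ?_⟩
  intro h M hM hb t ht
  have h1 : ∀ t ∈ Icc 0 T, |∫ s in (0:ℝ)..t, Real.exp (-(a * s)) * h s| ≤
      Real.exp (|a| * T) * T * M := by
    intro t ht
    have h2 : ∀ s ∈ uIoc 0 t, ‖Real.exp (-(a * s)) * h s‖ ≤ Real.exp (|a| * T) * M := by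
      intro s hs
      rw [uIoc_of_le ht.1] at hs
      rw [norm_mul, Real.norm_of_nonneg (Real.exp_pos _).le, Real.norm_eq_abs]
      have h3 : -(a * s) ≤ |a| * T := by
        calc -(a * s) = (-a) * s := by ring
          _ ≤ |a| * s := mul_le_mul_of_nonneg_right (neg_le_abs a) hs.1.le
          _ ≤ |a| * T := mul_le_mul_of_nonneg_left (hs.2.trans ht.2) (abs_nonneg a)
      exact mul_le_mul (Real.exp_le_exp.2 h3) (hb s ⟨hs.1.le, hs.2.trans ht.2⟩) (abs_nonneg _)
        (Real.exp_pos _).le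
    have h3 := intervalIntegral.norm_integral_le_of_norm_le_const h2
    rw [sub_zero, abs_of_nonneg ht.1, Real.norm_eq_abs] at h3
    refine h3.trans ?_
    calc Real.exp (|a| * T) * M * t ≤ Real.exp (|a| * T) * M * T := by
          have := ht.2; gcongr
      _ = _ := by ring
  have h4 : Real.exp (a * t) ≤ Real.exp (|a| * T) := by
    rw [Real.exp_le_exp]
    calc a * t ≤ |a| * t := mul_le_mul_of_nonneg_right (le_abs_self a) ht.1
      _ ≤ |a| * T := mul_le_mul_of_nonneg_left ht.2 (abs_nonneg a)
  have h5 := h1 t ht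
  have h6 := h1 T ⟨hT.le, le_rfl⟩
  rw [auxPer, abs_mul, abs_of_pos (Real.exp_pos _), mul_assoc]
  refine mul_le_mul h4 ?_ (abs_nonneg _) (Real.exp_pos _).le
  refine (abs_add_le _ _).trans ?_
  rw [abs_mul, add_mul]
  refine add_le_add ?_ h5
  rw [mul_assoc]
  exact mul_le_mul_of_nonneg_left h6 (abs_nonneg _)

/-- The solution operator on `C([0,T])`. -/
noncomputable def auxL (T : ℝ) (hT : 0 < T) (a : ℝ) (h : C(Icc (0:ℝ) T, ℝ)) : C(Icc (0:ℝ) T, ℝ) :=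
  ⟨fun t => auxPer T a (IccExtend hT.le h) t, by
    have : Continuous (auxPer T a (IccExtend hT.le h)) := continuous_iff_continuousAt.2 fun t =>
      (auxPer_hasDerivAt T a _ h.continuous.Icc_extend' t).continuousAt
    exact this.comp continuous_subtype_val⟩

lemma auxL_apply (T : ℝ) (hT : 0 < T) (a : ℝ) (h : C(Icc (0:ℝ) T, ℝ)) (t : Icc (0:ℝ) T) :
    auxL T hT a h t = auxPer T a (IccExtend hT.le h) t := rfl

lemma auxL_props (T : ℝ) (hT : 0 < T) (a : ℝ) : Continuous (auxL T hT a) ∧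
    ∃ C : ℝ, 0 ≤ C ∧ ∀ (h : C(Icc (0:ℝ) T, ℝ)) (M : ℝ), 0 ≤ M → (∀ t, |h t| ≤ M) →
      (∀ t, |auxL T hT a h t| ≤ C * M) ∧
      ∀ s t, |auxL T hT a h s - auxL T hT a h t| ≤ C * M * |(s:ℝ) - t| := by
  obtain ⟨C, hC, hb⟩ := auxPer_bound T a hT
  constructor
  · have : LipschitzWith (Real.toNNReal C) (auxL T hT a) := by
      refine LipschitzWith.of_dist_le_mul fun h k => ?_
      rw [Real.coe_toNNReal _ hC, ContinuousMap.dist_le (by positivity)]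
      intro t
      rw [Real.dist_eq, auxL_apply, auxL_apply, ← auxPer_sub _ _ _ _ h.continuous.Icc_extend'
        k.continuous.Icc_extend']
      refine hb _ _ dist_nonneg ?_ t t.2
      intro s hs
      rw [IccExtend_of_mem _ _ hs, IccExtend_of_mem _ _ hs, ← Real.dist_eq]
      exact ContinuousMap.dist_apply_le_dist _
    exact this.continuous
  · refine ⟨C + (|a| * C + 1), by positivity, ?_⟩
    intro h M hM hh
    have hh' : ∀ t ∈ Icc 0 T, |IccExtend hT.le h t| ≤ M := by
      intro t ht
      rw [IccExtend_of_mem _ _ ht]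
      exact hh _
    have h1 := hb _ M hM hh'
    constructor
    · intro t
      rw [auxL_apply]
      refine (h1 t t.2).trans ?_
      gcongr
      have : 0 ≤ |a| * C + 1 := by positivity
      linarith
    · intro s t
      rw [auxL_apply, auxL_apply]
      have h2 := Convex.norm_image_sub_le_of_norm_hasDerivWithin_le (s := Icc 0 T)
        (f := auxPer T a (IccExtend hT.le h)) (C := (|a| * C + 1) * M)
        (fun x hx => (auxPer_hasDerivAt T a _ h.continuous.Icc_extend' x).hasDerivWithinAt)
        (fun x hx => by
          rw [Real.norm_eq_abs]
          refine (abs_add_le _ _).trans ?_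
          rw [abs_mul, add_mul, one_mul, mul_assoc]
          exact add_le_add (mul_le_mul_of_nonneg_left (h1 x hx) (abs_nonneg _)) (hh' x hx))
        (convex_Icc _ _) t.2 s.2
      rw [Real.norm_eq_abs, Real.norm_eq_abs] at h2
      refine h2.trans ?_
      have h3 : (|a| * C + 1) * M ≤ (C + (|a| * C + 1)) * M :=
        mul_le_mul_of_nonneg_right (by linarith) hM
      exact mul_le_mul_of_nonneg_right h3 (abs_nonneg _)

/-- Compactness of bounded Lipschitz families. -/
lemma aux_ascoli (T R : ℝ) (hR : 0 ≤ R) : IsCompact {v : C(Icc (0:ℝ) T, ℝ × ℝ × ℝ × ℝ) |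
    (∀ t, ‖v t‖ ≤ R) ∧ ∀ s t, ‖v s - v t‖ ≤ R * |(s:ℝ) - t|} := by
  set A : Set (BoundedContinuousFunction (Icc (0:ℝ) T) (ℝ × ℝ × ℝ × ℝ)) :=
    {v | (∀ t, ‖v t‖ ≤ R) ∧ ∀ s t, ‖v s - v t‖ ≤ R * |(s:ℝ) - t|} with hA
  have hcA : IsCompact A := by
    refine BoundedContinuousFunction.arzela_ascoli₂ (closedBall 0 R) (isCompact_closedBall _ _) A ?_ ?_ ?_
    · have : A = (⋂ t : Icc (0:ℝ) T,
            {v : BoundedContinuousFunction (Icc (0:ℝ) T) (ℝ × ℝ × ℝ × ℝ) | ‖v t‖ ≤ R}) ∩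
          ⋂ s : Icc (0:ℝ) T, ⋂ t : Icc (0:ℝ) T,
            {v : BoundedContinuousFunction (Icc (0:ℝ) T) (ℝ × ℝ × ℝ × ℝ) |
              ‖v s - v t‖ ≤ R * |(s:ℝ) - t|} := by
        ext v
        simp only [hA, mem_inter_iff, mem_iInter, mem_ofPred_eq]
      rw [this]
      refine (isClosed_iInter fun t => ?_).inter (isClosed_iInter fun s => isClosed_iInter fun t => ?_)
      · exact isClosed_le (by fun_prop) continuous_const
      · exact isClosed_le (by fun_prop) continuous_const
    · intro v x hv
      exact mem_closedBall_zero_iff.2 (hv.1 x)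
    · refine (LipschitzWith.uniformEquicontinuous _ (Real.toNNReal R) fun v => ?_).equicontinuous
      refine LipschitzWith.of_dist_le_mul fun s t => ?_
      rw [dist_eq_norm, Real.coe_toNNReal _ hR]
      exact v.2.2 s t
  have := hcA.image (ContinuousMap.isometryEquivBoundedOfCompact (Icc (0:ℝ) T) (ℝ × ℝ × ℝ × ℝ)).symm.continuous
  have heq : {v : C(Icc (0:ℝ) T, ℝ × ℝ × ℝ × ℝ) |
      (∀ t, ‖v t‖ ≤ R) ∧ ∀ s t, ‖v s - v t‖ ≤ R * |(s:ℝ) - t|} =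
      (ContinuousMap.isometryEquivBoundedOfCompact (Icc (0:ℝ) T) (ℝ × ℝ × ℝ × ℝ)).symm '' A := by
    ext v
    constructor
    · intro hv
      exact ⟨ContinuousMap.isometryEquivBoundedOfCompact _ _ v, hv, IsometryEquiv.symm_apply_apply _ _⟩
    · rintro ⟨u, hu, rfl⟩
      exact hu
  rw [heq]
  exact this

/-- Existence for the modified (bounded) periodic problem. -/
lemma aux_modified (T : ℝ) (hT : 0 < T) (F G : ℝ × ℝ × ℝ × ℝ × ℝ → ℝ)
    (hF : ContinuousOn F (Icc 0 T ×ˢ univ)) (hG : ContinuousOn G (Icc 0 T ×ˢ univ))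
    (M : ℝ) (hFM : ∀ t ∈ Icc 0 T, ∀ x, |F (t, x)| ≤ M) (hGM : ∀ t ∈ Icc 0 T, ∀ x, |G (t, x)| ≤ M) :
    ∃ z w : ℝ → ℝ, ContDiff ℝ 2 z ∧ ContDiff ℝ 2 w ∧
      (∀ t ∈ Icc 0 T, deriv (deriv z) t = z t + F (t, z t, w t, deriv z t, deriv w t)) ∧
      (∀ t ∈ Icc 0 T, deriv (deriv w) t = w t + G (t, z t, w t, deriv z t, deriv w t)) ∧
      z 0 = z T ∧ deriv z 0 = deriv z T ∧ w 0 = w T ∧ deriv w 0 = deriv w T := by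
  have hM : 0 ≤ M := (abs_nonneg _).trans (hFM 0 ⟨le_rfl, hT.le⟩ 0)
  let Fc : C(Icc (0:ℝ) T × (ℝ × ℝ × ℝ × ℝ), ℝ) := ⟨fun p => F (p.1, p.2),
    hF.comp_continuous (by fun_prop) (fun p => ⟨p.1.2, mem_univ _⟩)⟩
  let Gc : C(Icc (0:ℝ) T × (ℝ × ℝ × ℝ × ℝ), ℝ) := ⟨fun p => G (p.1, p.2),
    hG.comp_continuous (by fun_prop) (fun p => ⟨p.1.2, mem_univ _⟩)⟩
  obtain ⟨hL1, C1, hC1, hb1⟩ := auxL_props T hT 1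
  obtain ⟨hL2, C2, hC2, hb2⟩ := auxL_props T hT (-1)
  let NF : C(Icc (0:ℝ) T, ℝ × ℝ × ℝ × ℝ) → C(Icc (0:ℝ) T, ℝ) :=
    fun v => Fc.comp ((ContinuousMap.id _).prodMk v)
  let NG : C(Icc (0:ℝ) T, ℝ × ℝ × ℝ × ℝ) → C(Icc (0:ℝ) T, ℝ) :=
    fun v => Gc.comp ((ContinuousMap.id _).prodMk v)
  have hNF : Continuous NF := by
    refine ContinuousMap.continuous_of_continuous_uncurry _ ?_
    change Continuous fun p : C(Icc (0:ℝ) T, ℝ × ℝ × ℝ × ℝ) × Icc (0:ℝ) T => Fc (p.2, p.1 p.2)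
    fun_prop
  have hNG : Continuous NG := by
    refine ContinuousMap.continuous_of_continuous_uncurry _ ?_
    change Continuous fun p : C(Icc (0:ℝ) T, ℝ × ℝ × ℝ × ℝ) × Icc (0:ℝ) T => Gc (p.2, p.1 p.2)
    fun_prop
  let Y1 := fun v => auxL T hT 1 (NF v)
  let Y2 := fun v => auxL T hT 1 (NG v)
  let Z1 := fun v => auxL T hT (-1) (Y1 v)
  let Z2 := fun v => auxL T hT (-1) (Y2 v)
  have hY1 : Continuous Y1 := hL1.comp hNF
  have hY2 : Continuous Y2 := hL1.comp hNG
  have hZ1 : Continuous Z1 := hL2.comp hY1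
  have hZ2 : Continuous Z2 := hL2.comp hY2
  let Φ : C(Icc (0:ℝ) T, ℝ × ℝ × ℝ × ℝ) → C(Icc (0:ℝ) T, ℝ × ℝ × ℝ × ℝ) := fun v =>
    (Z1 v).prodMk ((Z2 v).prodMk ((Y1 v - Z1 v).prodMk (Y2 v - Z2 v)))
  have hΦ : Continuous Φ := by
    refine ContinuousMap.continuous_of_continuous_uncurry _ ?_
    change Continuous fun p : C(Icc (0:ℝ) T, ℝ × ℝ × ℝ × ℝ) × Icc (0:ℝ) T =>
      (Z1 p.1 p.2, Z2 p.1 p.2, Y1 p.1 p.2 - Z1 p.1 p.2, Y2 p.1 p.2 - Z2 p.1 p.2)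
    fun_prop
  have hΦt : ∀ v t, Φ v t = (Z1 v t, Z2 v t, Y1 v t - Z1 v t, Y2 v t - Z2 v t) := fun _ _ => rfl
  obtain ⟨v, hv⟩ := aux_schauder Φ hΦ _ (aux_ascoli T (C1 * M + C2 * (C1 * M)) (by positivity)) (by
    intro v
    have hA1 := hb1 (NF v) M hM (fun t => hFM t t.2 _)
    have hA2 := hb1 (NG v) M hM (fun t => hGM t t.2 _)
    have hB1 := hb2 (Y1 v) (C1 * M) (by positivity) hA1.1
    have hB2 := hb2 (Y2 v) (C1 * M) (by positivity) hA2.1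
    have hp : 0 ≤ C1 * M := by positivity
    have hp2 : 0 ≤ C2 * (C1 * M) := by positivity
    constructor
    · intro t
      have e1 : |Y1 v t| ≤ _ := hA1.1 t
      have e2 : |Y2 v t| ≤ _ := hA2.1 t
      have e3 : |Z1 v t| ≤ _ := hB1.1 t
      have e4 : |Z2 v t| ≤ _ := hB2.1 t
      have e5 := abs_sub (Y1 v t) (Z1 v t)
      have e6 := abs_sub (Y2 v t) (Z2 v t)
      rw [hΦt]
      simp only [Prod.norm_def, sup_le_iff, Real.norm_eq_abs]
      refine ⟨?_, ?_, ?_, ?_⟩ <;> linarith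
    · intro s t
      have e1 : |Y1 v s - Y1 v t| ≤ _ := hA1.2 s t
      have e2 : |Y2 v s - Y2 v t| ≤ _ := hA2.2 s t
      have e3 : |Z1 v s - Z1 v t| ≤ _ := hB1.2 s t
      have e4 : |Z2 v s - Z2 v t| ≤ _ := hB2.2 s t
      have e5 := abs_sub (Y1 v s - Y1 v t) (Z1 v s - Z1 v t)
      have e6 := abs_sub (Y2 v s - Y2 v t) (Z2 v s - Z2 v t)
      have p1 : 0 ≤ C1 * M * |(s:ℝ) - t| := by positivity
      have p2 : 0 ≤ C2 * (C1 * M) * |(s:ℝ) - t| := by positivity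
      rw [hΦt, hΦt]
      simp only [Prod.norm_def, sup_le_iff, Real.norm_eq_abs, Prod.fst_sub, Prod.snd_sub, add_mul]
      refine ⟨?_, ?_, ?_, ?_⟩
      · linarith
      · linarith
      · rw [sub_sub_sub_comm]; linarith
      · rw [sub_sub_sub_comm]; linarith)
  have gen : ∀ N : C(Icc (0:ℝ) T, ℝ), ∃ z : ℝ → ℝ, ContDiff ℝ 2 z ∧
      (∀ t : Icc (0:ℝ) T, z t = auxL T hT (-1) (auxL T hT 1 N) t) ∧
      (∀ t : Icc (0:ℝ) T, deriv z t = auxL T hT 1 N t - auxL T hT (-1) (auxL T hT 1 N) t) ∧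
      (∀ t : Icc (0:ℝ) T, deriv (deriv z) t = z t + N t) ∧ z 0 = z T ∧ deriv z 0 = deriv z T := by
    intro N
    set h : ℝ → ℝ := IccExtend hT.le N with hh
    have hhc : Continuous h := N.continuous.Icc_extend'
    set y := auxPer T 1 h with hy
    have hyd : ∀ t, HasDerivAt y (1 * y t + h t) t := auxPer_hasDerivAt T 1 h hhc
    have hyc : Continuous y := continuous_iff_continuousAt.2 fun t => (hyd t).continuousAt
    set z := auxPer T (-1) y with hz
    have hzd : ∀ t, HasDerivAt z (-1 * z t + y t) t := auxPer_hasDerivAt T (-1) y hyc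
    have hzc : Continuous z := continuous_iff_continuousAt.2 fun t => (hzd t).continuousAt
    have hdz : deriv z = fun t => -1 * z t + y t := funext fun t => (hzd t).deriv
    have hdy : deriv y = fun t => 1 * y t + h t := funext fun t => (hyd t).deriv
    have hy1 : ContDiff ℝ 1 y := by
      rw [contDiff_one_iff_deriv]
      exact ⟨fun t => (hyd t).differentiableAt, by rw [hdy]; fun_prop⟩
    have hz1 : ContDiff ℝ 1 z := by
      rw [contDiff_one_iff_deriv]
      exact ⟨fun t => (hzd t).differentiableAt, by rw [hdz]; fun_prop⟩
    have hzeq : ∀ t : Icc (0:ℝ) T, z t = auxL T hT (-1) (auxL T hT 1 N) t := by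
      intro t
      rw [auxL_apply, hz]
      refine auxPer_congr _ _ _ _ (fun s hs => ?_) t t.2
      rw [IccExtend_of_mem _ _ hs]
      rfl
    have hz0 : z 0 = z T := auxPer_periodic T (-1) hT (by norm_num) y
    have hy0 : y 0 = y T := auxPer_periodic T 1 hT (by norm_num) h
    refine ⟨z, ?_, hzeq, ?_, ?_, hz0, ?_⟩
    · rw [show (2 : WithTop ℕ∞) = 1 + 1 by norm_num, contDiff_succ_iff_deriv]
      refine ⟨fun t => (hzd t).differentiableAt, by simp, ?_⟩
      rw [hdz]
      exact (contDiff_const.mul hz1).add hy1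
    · intro t
      rw [hdz, ← hzeq, auxL_apply]
      ring
    · intro t
      have : HasDerivAt (deriv z) (-1 * (-1 * z t + y t) + (1 * y t + h t)) t := by
        rw [hdz]
        exact ((hzd t).const_mul (-1)).add (hyd t)
      rw [this.deriv]
      have : h t = N t := by rw [hh, IccExtend_val]
      rw [this]; ring
    · rw [hdz]; simp only [hz0, hy0]
  obtain ⟨z, hz2, hza, hzb, hzc, hzd, hze⟩ := gen (NF v)
  obtain ⟨w, hw2, hwa, hwb, hwc, hwd, hwe⟩ := gen (NG v)
  have hvt : ∀ t : Icc (0:ℝ) T, v t = (z t, w t, deriv z t, deriv w t) := by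
    intro t
    rw [hza, hwa, hzb, hwb]
    conv_lhs => rw [← hv]
    rfl
  refine ⟨z, w, hz2, hw2, ?_, ?_, hzd, hze, hwd, hwe⟩
  · intro t ht
    rw [hzc ⟨t, ht⟩, ← hvt ⟨t, ht⟩]
    rfl
  · intro t ht
    rw [hwc ⟨t, ht⟩, ← hvt ⟨t, ht⟩]
    rfl


lemma aux_second (T : ℝ) (u : ℝ → ℝ) (hu : ContDiff ℝ 2 u) (t₀ : ℝ) (h0 : 0 ≤ t₀) (h1 : t₀ < T)
    (hmin : ∀ t ∈ Icc 0 T, u t₀ ≤ u t) (hd : deriv u t₀ = 0) : 0 ≤ deriv (deriv u) t₀ := by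
  by_contra! hneg
  have hc1 : ContDiff ℝ 1 (deriv u) := by
    have h2 : ContDiff ℝ (1 + 1) u := by
      rw [show (1 + 1 : WithTop ℕ∞) = 2 by norm_num]; exact hu
    exact (contDiff_succ_iff_deriv.1 h2).2.2
  have hc0 : Continuous (deriv (deriv u)) := hc1.continuous_deriv_one
  have hev : ∀ᶠ t in nhds t₀, deriv (deriv u) t < 0 := hc0.continuousAt.eventually_lt_const hneg
  obtain ⟨ε, hε, hball⟩ := Metric.eventually_nhds_iff.1 hev
  set r := min (t₀ + ε / 2) T with hr
  have hr1 : t₀ < r := lt_min (by linarith) h1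
  have hr2 : r ≤ T := min_le_right _ _
  have hr3 : r ≤ t₀ + ε / 2 := min_le_left _ _
  have hanti : StrictAntiOn (deriv u) (Icc t₀ r) := by
    refine strictAntiOn_of_deriv_neg (convex_Icc _ _) hc1.continuous.continuousOn fun x hx => ?_
    rw [interior_Icc] at hx
    refine hball ?_
    rw [Real.dist_eq, abs_lt]
    constructor <;> linarith [hx.1, hx.2]
  have hanti2 : StrictAntiOn u (Icc t₀ r) := by
    refine strictAntiOn_of_deriv_neg (convex_Icc _ _) hu.continuous.continuousOn fun x hx => ?_
    rw [interior_Icc] at hx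
    rw [← hd]
    exact hanti ⟨le_rfl, hr1.le⟩ ⟨hx.1.le, hx.2.le⟩ hx.1
  have h3 := hanti2 ⟨le_rfl, hr1.le⟩ ⟨hr1.le, le_rfl⟩ hr1
  have h4 := hmin r ⟨by linarith, hr2⟩
  linarith

lemma aux_loc (T : ℝ) (hT : 0 < T) (z γ : ℝ → ℝ) (hz : ContDiff ℝ 2 z) (hγ : ContDiff ℝ 2 γ)
    (hz0 : z 0 = z T) (hz1 : deriv z 0 = deriv z T) (hγ0 : γ 0 = γ T)
    (hγ1 : deriv γ T ≤ deriv γ 0)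
    (H : ∀ t ∈ Icc 0 T, z t < γ t → deriv z t = deriv γ t →
      deriv (deriv z) t < deriv (deriv γ) t) :
    ∀ t ∈ Icc 0 T, γ t ≤ z t := by
  have hdz : Differentiable ℝ z := hz.differentiable (by norm_num)
  have hdγ : Differentiable ℝ γ := hγ.differentiable (by norm_num)
  have c1 : ∀ v : ℝ → ℝ, ContDiff ℝ 2 v → Differentiable ℝ (deriv v) := by
    intro v hv
    have h2 : ContDiff ℝ (1 + 1) v := by
      rw [show (1 + 1 : WithTop ℕ∞) = 2 by norm_num]; exact hv
    exact (contDiff_succ_iff_deriv.1 h2).2.2.differentiable (by norm_num)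
  set u : ℝ → ℝ := fun t => z t - γ t with hu
  have hu2 : ContDiff ℝ 2 u := hz.sub hγ
  have hdu : deriv u = fun t => deriv z t - deriv γ t := by
    funext t; exact deriv_fun_sub (hdz t) (hdγ t)
  have hddu : ∀ t, deriv (deriv u) t = deriv (deriv z) t - deriv (deriv γ) t := by
    intro t; rw [hdu]; exact deriv_fun_sub (c1 z hz t) (c1 γ hγ t)
  have hudiff : Differentiable ℝ u := hdz.sub hdγ
  obtain ⟨t₀, ht₀, hmin⟩ := isCompact_Icc.exists_isMinOn (nonempty_Icc.2 hT.le)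
    hu2.continuous.continuousOn (s := Icc 0 T)
  have hmin : ∀ t ∈ Icc 0 T, u t₀ ≤ u t := fun t ht => hmin ht
  by_contra! hcon
  obtain ⟨s, hs, hsn⟩ := hcon
  have hneg : u t₀ < 0 := by
    have := hmin s hs
    simp only [hu] at this ⊢
    linarith
  have key : ∀ t₁, 0 ≤ t₁ → t₁ < T → u t₁ = u t₀ → deriv u t₁ = 0 → False := by
    intro t₁ a b c d
    have h1 := aux_second T u hu2 t₁ a b (by rw [c]; exact hmin) d
    rw [hddu] at h1
    have h2 := H t₁ ⟨a, b.le⟩ (by rw [← c] at hneg; simp only [hu] at hneg; linarith)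
      (by rw [hdu] at d; simp only at d; linarith)
    linarith
  have hu0T : u 0 = u T := by simp only [hu, hz0, hγ0]
  by_cases hInt : t₀ ∈ Ioo 0 T
  · refine key t₀ hInt.1.le hInt.2 rfl ?_
    have : IsLocalMin u t₀ := by
      filter_upwards [Icc_mem_nhds hInt.1 hInt.2] with t ht using hmin t ht
    exact this.deriv_eq_zero
  · have h0 : u 0 = u t₀ := by
      rcases eq_or_lt_of_le ht₀.1 with h | h
      · rw [h]
      · rcases eq_or_lt_of_le ht₀.2 with h' | h'
        · rw [hu0T, h']
        · exact absurd ⟨h, h'⟩ hInt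
    refine key 0 le_rfl hT h0 ?_
    have hA : 0 ≤ deriv u 0 := by
      have h1 : HasDerivWithinAt u (deriv u 0) (Ioi 0) 0 := (hudiff 0).hasDerivAt.hasDerivWithinAt
      rw [hasDerivWithinAt_iff_tendsto_slope' (by simp)] at h1
      refine ge_of_tendsto h1 ?_
      filter_upwards [Ioo_mem_nhdsGT hT] with t ht
      rw [slope_def_field]
      have := hmin t ⟨ht.1.le, ht.2.le⟩
      exact div_nonneg (by linarith) (by linarith [ht.1])
    have hB : deriv u T ≤ 0 := by
      have h1 : HasDerivWithinAt u (deriv u T) (Iio T) T := (hudiff T).hasDerivAt.hasDerivWithinAt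
      rw [hasDerivWithinAt_iff_tendsto_slope' (by simp)] at h1
      refine le_of_tendsto h1 ?_
      filter_upwards [Ioo_mem_nhdsLT hT] with t ht
      rw [slope_def_field]
      have := hmin t ⟨ht.1.le, ht.2.le⟩
      exact div_nonpos_of_nonneg_of_nonpos (by linarith) (by linarith [ht.2])
    have hC : deriv u 0 ≤ deriv u T := by
      rw [hdu]; simp only; linarith
    linarith

lemma aux_loc_up (T : ℝ) (hT : 0 < T) (z γ : ℝ → ℝ) (hz : ContDiff ℝ 2 z) (hγ : ContDiff ℝ 2 γ)
    (hz0 : z 0 = z T) (hz1 : deriv z 0 = deriv z T) (hγ0 : γ 0 = γ T)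
    (hγ1 : deriv γ 0 ≤ deriv γ T)
    (H : ∀ t ∈ Icc 0 T, γ t < z t → deriv z t = deriv γ t →
      deriv (deriv γ) t < deriv (deriv z) t) :
    ∀ t ∈ Icc 0 T, z t ≤ γ t := by
  have hd : ∀ v : ℝ → ℝ, deriv (fun t => - v t) = fun t => - deriv v t := by
    intro v; funext t; exact deriv.fun_neg
  have := aux_loc T hT (fun t => - z t) (fun t => - γ t) hz.neg hγ.neg (by simp [hz0])
    (by rw [hd]; simp [hz1]) (by simp [hγ0]) (by rw [hd]; simpa using hγ1) (by
      intro t ht h1 h2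
      rw [hd, hd] at h2
      rw [hd, hd, hd, hd]
      have := H t ht (by linarith) (by simpa using h2)
      linarith)
  intro t ht
  have := this t ht
  linarith

/-- Large `N` for the Nagumo condition. -/
lemma aux_large (φ : ℝ → ℝ) (hφ : ContinuousOn φ (Ici 0)) (hpos : ∀ s ∈ Ici (0:ℝ), 0 < φ s)
    (hInt : (∫⁻ s in Ici (0:ℝ), ENNReal.ofReal (1 / φ s)) = ⊤) (T : ℝ) :
    ∃ N₀ : ℝ, 0 ≤ N₀ ∧ ∀ N, N₀ ≤ N → T < ∫ s in (0:ℝ)..N, 1 / φ s := by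
  have hc : ContinuousOn (fun s => 1 / φ s) (Ici 0) :=
    continuousOn_const.div hφ fun s hs => (hpos s hs).ne'
  have hii : ∀ a b : ℝ, 0 ≤ a → a ≤ b → IntervalIntegrable (fun s => 1 / φ s) volume a b := by
    intro a b ha hab
    refine (hc.mono ?_).intervalIntegrable
    rw [uIcc_of_le hab]
    exact fun x hx => ha.trans hx.1
  have hmono : ∀ a b : ℝ, 0 ≤ a → a ≤ b →
      (∫ s in (0:ℝ)..a, 1 / φ s) ≤ ∫ s in (0:ℝ)..b, 1 / φ s := by
    intro a b ha hab
    rw [← intervalIntegral.integral_add_adjacent_intervals (hii 0 a le_rfl ha) (hii a b ha hab)]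
    have : 0 ≤ ∫ s in a..b, 1 / φ s := intervalIntegral.integral_nonneg hab
      fun s hs => (one_div_pos.2 (hpos s (ha.trans hs.1))).le
    linarith
  by_contra! hcon
  have hb : ∀ N, 0 ≤ N → (∫ s in (0:ℝ)..N, 1 / φ s) ≤ T := by
    intro N hN
    obtain ⟨N', h1, h2⟩ := hcon N hN
    exact (hmono N N' hN h1).trans h2
  have hI : IntegrableOn (fun s => 1 / φ s) (Ioi 0) := by
    refine integrableOn_Ioi_of_intervalIntegral_norm_bounded (l := Filter.atTop) (b := fun N : ℝ => N) T 0 ?_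
      Filter.tendsto_id ?_
    · intro i
      rcases le_total 0 i with h | h
      · exact (intervalIntegrable_iff_integrableOn_Ioc_of_le h).1 (hii 0 i le_rfl h)
      · rw [Ioc_eq_empty (by linarith)]; exact integrableOn_empty
    · filter_upwards [Filter.eventually_ge_atTop 0] with N hN
      refine le_trans (le_of_eq ?_) (hb N hN)
      refine intervalIntegral.integral_congr fun s hs => ?_
      rw [uIcc_of_le hN] at hs
      exact Real.norm_of_nonneg (one_div_pos.2 (hpos s hs.1)).le
  have hI2 : IntegrableOn (fun s => 1 / φ s) (Ici 0) := by
    rw [integrableOn_Ici_iff_integrableOn_Ioi]; exact hI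
  have h3 := hI2.lintegral_lt_top
  rw [hInt] at h3
  exact lt_irrefl _ h3

/-- A priori derivative bound. -/
lemma aux_nagumo_one (T : ℝ) (hT : 0 < T) (φ : ℝ → ℝ) (hφ : ContinuousOn φ (Ici 0))
    (hpos : ∀ s ∈ Ici (0:ℝ), 0 < φ s) (N : ℝ) (hN : 0 ≤ N)
    (hbig : T < ∫ s in (0:ℝ)..N, 1 / φ s) (z : ℝ → ℝ) (hz : ContDiff ℝ 2 z) (hz0 : z 0 = z T)
    (hb : ∀ t ∈ Icc 0 T, |deriv (deriv z) t| ≤ φ |max (-N) (min (deriv z t) N)|) :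
    ∀ t ∈ Icc 0 T, deriv z t ≤ N := by
  have hc1 : ContDiff ℝ 1 (deriv z) := by
    have h2 : ContDiff ℝ (1 + 1) z := by
      rw [show (1 + 1 : WithTop ℕ∞) = 2 by norm_num]; exact hz
    exact (contDiff_succ_iff_deriv.1 h2).2.2
  have hd1 : Differentiable ℝ (deriv z) := hc1.differentiable (by norm_num)
  obtain ⟨t₀, ht₀, hd0⟩ := exists_deriv_eq_zero hT hz.continuous.continuousOn hz0
  set κ : ℝ → ℝ := fun r => 1 / φ |max (-N) (min r N)| with hκ
  have hκpos : ∀ r, 0 < κ r := fun r => one_div_pos.2 (hpos _ (mem_Ici.2 (abs_nonneg _)))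
  have hκc : Continuous κ := by
    refine continuous_const.div (hφ.comp_continuous (by fun_prop) fun r => mem_Ici.2 (abs_nonneg _))
      fun r => (hpos _ (mem_Ici.2 (abs_nonneg _))).ne'
  set Ψ : ℝ → ℝ := fun s => ∫ r in (0:ℝ)..s, κ r with hΨ
  have hΨd : ∀ s, HasDerivAt Ψ (κ s) s := fun s => hκc.integral_hasStrictDerivAt 0 s |>.hasDerivAt
  have hΨm : StrictMono Ψ := strictMono_of_deriv_pos fun s => by rw [(hΨd s).deriv]; exact hκpos s
  have hΨN : T < Ψ N := by
    refine lt_of_lt_of_eq hbig ?_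
    refine intervalIntegral.integral_congr fun s hs => ?_
    rw [uIcc_of_le hN] at hs
    simp only [hκ]
    rw [min_eq_left hs.2, max_eq_right (by linarith [hs.1]), abs_of_nonneg hs.1]
  intro t ht
  by_contra! hcon
  have hcomp : ∀ x, HasDerivAt (fun x => Ψ (deriv z x)) (κ (deriv z x) * deriv (deriv z) x) x :=
    fun x => (hΨd _).comp x (hd1 x).hasDerivAt
  have h2 := Convex.norm_image_sub_le_of_norm_hasDerivWithin_le (s := Icc 0 T)
    (f := fun x => Ψ (deriv z x)) (C := 1) (fun x hx => (hcomp x).hasDerivWithinAt)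
    (fun x hx => by
      rw [Real.norm_eq_abs, abs_mul, abs_of_pos (hκpos _)]
      simp only [hκ]
      rw [one_div, inv_mul_le_iff₀ (hpos _ (mem_Ici.2 (abs_nonneg _))), mul_one]
      exact hb x hx)
    (convex_Icc _ _) ⟨ht₀.1.le, ht₀.2.le⟩ ht
  have hΨ0 : Ψ 0 = 0 := by simp [hΨ]
  simp only [hd0, hΨ0, sub_zero, Real.norm_eq_abs, one_mul] at h2
  have h3 : |t - t₀| ≤ T := by
    rw [abs_le]; constructor <;> linarith [ht.1, ht.2, ht₀.1, ht₀.2]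
  have h4 := hΨm hcon
  have h5 := le_abs_self (Ψ (deriv z t))
  linarith

lemma aux_nagumo (T : ℝ) (hT : 0 < T) (φ : ℝ → ℝ) (hφ : ContinuousOn φ (Ici 0))
    (hpos : ∀ s ∈ Ici (0:ℝ), 0 < φ s) (N : ℝ) (hN : 0 ≤ N)
    (hbig : T < ∫ s in (0:ℝ)..N, 1 / φ s) (z : ℝ → ℝ) (hz : ContDiff ℝ 2 z) (hz0 : z 0 = z T)
    (hb : ∀ t ∈ Icc 0 T, |deriv (deriv z) t| ≤ φ |max (-N) (min (deriv z t) N)|) :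
    ∀ t ∈ Icc 0 T, -N ≤ deriv z t ∧ deriv z t ≤ N := by
  have hd : ∀ v : ℝ → ℝ, deriv (fun t => - v t) = fun t => - deriv v t := by
    intro v; funext t; exact deriv.fun_neg
  intro t ht
  refine ⟨?_, aux_nagumo_one T hT φ hφ hpos N hN hbig z hz hz0 hb t ht⟩
  have := aux_nagumo_one T hT φ hφ hpos N hN hbig (fun t => - z t) hz.neg (by simp [hz0]) (by
    intro t ht
    rw [hd, hd, abs_neg]
    have h1 : |max (-N) (min (-deriv z t) N)| = |max (-N) (min (deriv z t) N)| := by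
      set d := deriv z t with hdd
      rcases le_total d (-N) with h | h
      · rw [min_eq_left (show d ≤ N by linarith), max_eq_left h,
          min_eq_right (show N ≤ -d by linarith), max_eq_right (show -N ≤ N by linarith), abs_neg]
      · rcases le_total d N with h' | h'
        · rw [min_eq_left h', max_eq_right h, min_eq_left (show -d ≤ N by linarith),
            max_eq_right (show -N ≤ -d by linarith), abs_neg]
        · rw [min_eq_right h', max_eq_right (show -N ≤ N by linarith),
            min_eq_left (show -d ≤ N by linarith), max_eq_left (show -d ≤ -N by linarith), abs_neg]
    rw [h1]; exact hb t ht) t ht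
  rw [hd] at this
  linarith


lemma aux_bdd (T : ℝ) (f : ℝ → ℝ → ℝ → ℝ → ℝ → ℝ)
    (hf : ContinuousOn (fun p : ℝ × ℝ × ℝ × ℝ × ℝ =>
      f p.1 p.2.1 p.2.2.1 p.2.2.2.1 p.2.2.2.2)
      (Set.Icc 0 T ×ˢ (Set.univ : Set (ℝ × ℝ × ℝ × ℝ)))) (R : ℝ) :
    ∃ M, ∀ t ∈ Icc 0 T, ∀ a ∈ Icc (-R) R, ∀ b ∈ Icc (-R) R, ∀ c ∈ Icc (-R) R, ∀ d ∈ Icc (-R) R,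
      |f t a b c d| ≤ M := by
  have hK : IsCompact (Icc 0 T ×ˢ (Icc (-R) R ×ˢ (Icc (-R) R ×ˢ (Icc (-R) R ×ˢ Icc (-R) R)))) :=
    isCompact_Icc.prod (isCompact_Icc.prod (isCompact_Icc.prod (isCompact_Icc.prod isCompact_Icc)))
  obtain ⟨M, hM⟩ := hK.exists_bound_of_continuousOn
    (hf.mono (prod_mono Subset.rfl (subset_univ _)))
  exact ⟨M, fun t ht a ha b hb c hc d hd => hM (t, a, b, c, d) ⟨ht, ha, hb, hc, hd⟩⟩

lemma aux_supNorm (T : ℝ) (α : ℝ → ℝ) (hα : Continuous α) :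
    ∀ t ∈ Icc 0 T, |α t| ≤ supNorm T α := by
  intro t ht
  exact le_csSup (isCompact_Icc.image hα.abs).bddAbove ⟨t, ht, rfl⟩

lemma aux_deriv_cont (v : ℝ → ℝ) (hv : ContDiff ℝ 2 v) : Continuous (deriv v) :=
  hv.continuous_deriv (by norm_num)

lemma aux_deriv_bd (T : ℝ) (v : ℝ → ℝ) (hv : ContDiff ℝ 2 v) :
    ∃ B, ∀ t ∈ Icc 0 T, |deriv v t| ≤ B :=
  isCompact_Icc.exists_bound_of_continuousOn (aux_deriv_cont v hv).continuousOn

lemma aux_deriv_range (T : ℝ) (v : ℝ → ℝ) (hv : ContDiff ℝ 2 v) : ∀ t ∈ Icc 0 T,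
    sInf (deriv v '' Icc 0 T) ≤ deriv v t ∧ deriv v t ≤ sSup (deriv v '' Icc 0 T) := by
  intro t ht
  have hc := isCompact_Icc.image (aux_deriv_cont v hv) (s := Icc 0 T)
  exact ⟨csInf_le hc.bddBelow ⟨t, ht, rfl⟩, le_csSup hc.bddAbove ⟨t, ht, rfl⟩⟩

/-- Truncation is the identity on the interval. -/
lemma aux_trunc_mem {a b x : ℝ} (h1 : a ≤ x) (h2 : x ≤ b) : max a (min x b) = x := by
  rw [min_eq_left h2, max_eq_right h1]

lemma aux_trunc_range {a b x : ℝ} (h : a ≤ b) : a ≤ max a (min x b) ∧ max a (min x b) ≤ b :=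
  ⟨le_max_left _ _, max_le h (min_le_right _ _)⟩

lemma aux_trunc_low {a b x : ℝ} (h1 : x ≤ a) : max a (min x b) = a :=
  max_eq_left ((min_le_left _ _).trans h1)

lemma aux_trunc_up {a b x : ℝ} (h : a ≤ b) (h1 : b ≤ x) : max a (min x b) = b := by
  rw [min_eq_right h1, max_eq_right h]

lemma aux_lowShift_deriv (T : ℝ) (α : ℝ → ℝ) : deriv (lowShift T α) = deriv α := by
  funext t; exact deriv_sub_const _

lemma aux_upShift_deriv (T : ℝ) (α : ℝ → ℝ) : deriv (upShift T α) = deriv α := by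
  funext t; exact deriv_add_const _

end AuxPart

/-- Main existence and localization theorem: under orderless lower and upper
solutions, a Nagumo-type condition and the monotonicity assumptions, the
second-order coupled system with periodic boundary conditions has at least one
solution, localized between the shifted lower and upper solutions. -/
theorem stmt_2
    (T : ℝ) (hT : 0 < T)
    (f g : ℝ → ℝ → ℝ → ℝ → ℝ → ℝ)
    (hf : ContinuousOn (fun p : ℝ × ℝ × ℝ × ℝ × ℝ =>
      f p.1 p.2.1 p.2.2.1 p.2.2.2.1 p.2.2.2.2)
      (Set.Icc 0 T ×ˢ (Set.univ : Set (ℝ × ℝ × ℝ × ℝ))))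
    (hg : ContinuousOn (fun p : ℝ × ℝ × ℝ × ℝ × ℝ =>
      g p.1 p.2.1 p.2.2.1 p.2.2.2.1 p.2.2.2.2)
      (Set.Icc 0 T ×ˢ (Set.univ : Set (ℝ × ℝ × ℝ × ℝ))))
    (α₁ α₂ β₁ β₂ : ℝ → ℝ)
    (hlow : IsLowerSolution T f g α₁ α₂)
    (hupp : IsUpperSolution T f g β₁ β₂)
    (φ ψ : ℝ → ℝ)
    (hNag : NagumoCondition T f g (lowShift T α₁) (upShift T β₁)
      (lowShift T α₂) (upShift T β₂) φ ψ)
    (hfmono : ∀ t ∈ Set.Icc 0 T, ∀ z₀ z₁ w₁ : ℝ,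
      min (sInf (deriv α₁ '' Set.Icc 0 T)) (sInf (deriv β₁ '' Set.Icc 0 T)) ≤ z₁ →
      z₁ ≤ max (sSup (deriv α₁ '' Set.Icc 0 T)) (sSup (deriv β₁ '' Set.Icc 0 T)) →
      ∀ w₀ w₀' : ℝ, w₀ ≤ w₀' → f t z₀ w₀' z₁ w₁ ≤ f t z₀ w₀ z₁ w₁)
    (hgmono : ∀ t ∈ Set.Icc 0 T, ∀ w₀ z₁ w₁ : ℝ,
      min (sInf (deriv α₂ '' Set.Icc 0 T)) (sInf (deriv β₂ '' Set.Icc 0 T)) ≤ w₁ →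
      w₁ ≤ max (sSup (deriv α₂ '' Set.Icc 0 T)) (sSup (deriv β₂ '' Set.Icc 0 T)) →
      ∀ z₀ z₀' : ℝ, z₀ ≤ z₀' → g t z₀' w₀ z₁ w₁ ≤ g t z₀ w₀ z₁ w₁)
    :
    ∃ z w : ℝ → ℝ, ContDiff ℝ 2 z ∧ ContDiff ℝ 2 w ∧
      (∀ t ∈ Set.Icc 0 T,
        deriv (deriv z) t = f t (z t) (w t) (deriv z t) (deriv w t)) ∧
      (∀ t ∈ Set.Icc 0 T,
        deriv (deriv w) t = g t (z t) (w t) (deriv z t) (deriv w t)) ∧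
      PBC T z w ∧
      (∀ t ∈ Set.Icc 0 T,
        lowShift T α₁ t ≤ z t ∧ z t ≤ upShift T β₁ t ∧
        lowShift T α₂ t ≤ w t ∧ w t ≤ upShift T β₂ t) := by
  obtain ⟨ha1, ha2, hla1, hla2, hpa1, hpa2, hda1, hda2⟩ := hlow
  obtain ⟨hb1, hb2, hub1, hub2, hpb1, hpb2, hdb1, hdb2⟩ := hupp
  obtain ⟨hφc, hψc, hφp, hψp, hφi, hψi, hN⟩ := hNag
  -- the shifted functions
  set a₁ := lowShift T α₁ with ea1
  set a₂ := lowShift T α₂ with ea2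
  set b₁ := upShift T β₁ with eb1
  set b₂ := upShift T β₂ with eb2
  have ca1 : ContDiff ℝ 2 a₁ := ha1.sub contDiff_const
  have ca2 : ContDiff ℝ 2 a₂ := ha2.sub contDiff_const
  have cb1 : ContDiff ℝ 2 b₁ := hb1.add contDiff_const
  have cb2 : ContDiff ℝ 2 b₂ := hb2.add contDiff_const
  have ka1 := ca1.continuous
  have ka2 := ca2.continuous
  have kb1 := cb1.continuous
  have kb2 := cb2.continuous
  have da1 : deriv a₁ = deriv α₁ := aux_lowShift_deriv T α₁
  have da2 : deriv a₂ = deriv α₂ := aux_lowShift_deriv T α₂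
  have db1 : deriv b₁ = deriv β₁ := aux_upShift_deriv T β₁
  have db2 : deriv b₂ = deriv β₂ := aux_upShift_deriv T β₂
  have pa1 : a₁ 0 = a₁ T := by simp only [ea1, lowShift, hpa1]
  have pa2 : a₂ 0 = a₂ T := by simp only [ea2, lowShift, hpa2]
  have pb1 : b₁ 0 = b₁ T := by simp only [eb1, upShift, hpb1]
  have pb2 : b₂ 0 = b₂ T := by simp only [eb2, upShift, hpb2]
  have sa1 := aux_supNorm T α₁ ha1.continuous
  have sa2 := aux_supNorm T α₂ ha2.continuous
  have sb1 := aux_supNorm T β₁ hb1.continuous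
  have sb2 := aux_supNorm T β₂ hb2.continuous
  have h0T : (0:ℝ) ∈ Set.Icc 0 T := ⟨le_rfl, hT.le⟩
  have na1 := (abs_nonneg _).trans (sa1 0 h0T)
  have na2 := (abs_nonneg _).trans (sa2 0 h0T)
  have nb1 := (abs_nonneg _).trans (sb1 0 h0T)
  have nb2 := (abs_nonneg _).trans (sb2 0 h0T)
  have ra1 : ∀ t ∈ Set.Icc 0 T, -(2 * supNorm T α₁) ≤ a₁ t ∧ a₁ t ≤ 0 := by
    intro t ht
    have := abs_le.1 (sa1 t ht)
    simp only [ea1, lowShift]; constructor <;> linarith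
  have ra2 : ∀ t ∈ Set.Icc 0 T, -(2 * supNorm T α₂) ≤ a₂ t ∧ a₂ t ≤ 0 := by
    intro t ht
    have := abs_le.1 (sa2 t ht)
    simp only [ea2, lowShift]; constructor <;> linarith
  have rb1 : ∀ t ∈ Set.Icc 0 T, 0 ≤ b₁ t ∧ b₁ t ≤ 2 * supNorm T β₁ := by
    intro t ht
    have := abs_le.1 (sb1 t ht)
    simp only [eb1, upShift]; constructor <;> linarith
  have rb2 : ∀ t ∈ Set.Icc 0 T, 0 ≤ b₂ t ∧ b₂ t ≤ 2 * supNorm T β₂ := by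
    intro t ht
    have := abs_le.1 (sb2 t ht)
    simp only [eb2, upShift]; constructor <;> linarith
  -- the a priori bound for the derivatives
  obtain ⟨N₁, hN₁, hbig₁⟩ := aux_large φ hφc hφp hφi T
  obtain ⟨N₂, hN₂, hbig₂⟩ := aux_large ψ hψc hψp hψi T
  obtain ⟨A₁, hA₁⟩ := aux_deriv_bd T α₁ ha1
  obtain ⟨A₂, hA₂⟩ := aux_deriv_bd T α₂ ha2
  obtain ⟨B₁, hB₁⟩ := aux_deriv_bd T β₁ hb1
  obtain ⟨B₂, hB₂⟩ := aux_deriv_bd T β₂ hb2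
  have nA₁ := (abs_nonneg _).trans (hA₁ 0 h0T)
  have nA₂ := (abs_nonneg _).trans (hA₂ 0 h0T)
  have nB₁ := (abs_nonneg _).trans (hB₁ 0 h0T)
  have nB₂ := (abs_nonneg _).trans (hB₂ 0 h0T)
  obtain ⟨N, eN⟩ : ∃ N, N = N₁ + N₂ + A₁ + A₂ + B₁ + B₂ := ⟨_, rfl⟩
  have hN0 : 0 ≤ N := by linarith
  have hNN : -N ≤ N := by linarith
  have big₁ := hbig₁ N (by linarith)
  have big₂ := hbig₂ N (by linarith)
  obtain ⟨R, eR⟩ : ∃ R, R = N + 2 * supNorm T α₁ + 2 * supNorm T α₂ + 2 * supNorm T β₁ +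
    2 * supNorm T β₂ := ⟨_, rfl⟩
  obtain ⟨M₁, hM₁⟩ := aux_bdd T f hf R
  obtain ⟨M₂, hM₂⟩ := aux_bdd T g hg R
  -- truncations
  have δ₁r : ∀ t ∈ Set.Icc 0 T, ∀ x, a₁ t ≤ max (a₁ t) (min x (b₁ t)) ∧
      max (a₁ t) (min x (b₁ t)) ≤ b₁ t := fun t ht x =>
    aux_trunc_range ((ra1 t ht).2.trans (rb1 t ht).1)
  have δ₂r : ∀ t ∈ Set.Icc 0 T, ∀ x, a₂ t ≤ max (a₂ t) (min x (b₂ t)) ∧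
      max (a₂ t) (min x (b₂ t)) ≤ b₂ t := fun t ht x =>
    aux_trunc_range ((ra2 t ht).2.trans (rb2 t ht).1)
  have δ₁R : ∀ t ∈ Set.Icc 0 T, ∀ x, max (a₁ t) (min x (b₁ t)) ∈ Set.Icc (-R) R := by
    intro t ht x
    have h1 := δ₁r t ht x
    have h2 := ra1 t ht
    have h3 := rb1 t ht
    constructor <;> linarith
  have δ₂R : ∀ t ∈ Set.Icc 0 T, ∀ x, max (a₂ t) (min x (b₂ t)) ∈ Set.Icc (-R) R := by
    intro t ht x
    have h1 := δ₂r t ht x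
    have h2 := ra2 t ht
    have h3 := rb2 t ht
    constructor <;> linarith
  have qR : ∀ p : ℝ, max (-N) (min p N) ∈ Set.Icc (-R) R := by
    intro p
    have h1 := aux_trunc_range (x := p) hNN
    constructor <;> linarith
  -- the modified problem
  obtain ⟨z, w, hz, hw, hzz, hww, pz, pdz, pw, pdw⟩ := aux_modified T hT
    (fun p => f p.1 (max (a₁ p.1) (min p.2.1 (b₁ p.1))) (max (a₂ p.1) (min p.2.2.1 (b₂ p.1)))
      (max (-N) (min p.2.2.2.1 N)) (max (-N) (min p.2.2.2.2 N)) -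
        max (a₁ p.1) (min p.2.1 (b₁ p.1)))
    (fun p => g p.1 (max (a₁ p.1) (min p.2.1 (b₁ p.1))) (max (a₂ p.1) (min p.2.2.1 (b₂ p.1)))
      (max (-N) (min p.2.2.2.1 N)) (max (-N) (min p.2.2.2.2 N)) -
        max (a₂ p.1) (min p.2.2.1 (b₂ p.1)))
    (by
      refine ContinuousOn.sub (hf.comp (f := fun p : ℝ × ℝ × ℝ × ℝ × ℝ => (p.1,
        max (a₁ p.1) (min p.2.1 (b₁ p.1)), max (a₂ p.1) (min p.2.2.1 (b₂ p.1)),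
        max (-N) (min p.2.2.2.1 N), max (-N) (min p.2.2.2.2 N))) ?_ ?_) ?_
      · exact Continuous.continuousOn (by fun_prop)
      · exact fun p hp => ⟨hp.1, Set.mem_univ _⟩
      · exact Continuous.continuousOn (by fun_prop))
    (by
      refine ContinuousOn.sub (hg.comp (f := fun p : ℝ × ℝ × ℝ × ℝ × ℝ => (p.1,
        max (a₁ p.1) (min p.2.1 (b₁ p.1)), max (a₂ p.1) (min p.2.2.1 (b₂ p.1)),
        max (-N) (min p.2.2.2.1 N), max (-N) (min p.2.2.2.2 N))) ?_ ?_) ?_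
      · exact Continuous.continuousOn (by fun_prop)
      · exact fun p hp => ⟨hp.1, Set.mem_univ _⟩
      · exact Continuous.continuousOn (by fun_prop))
    (max M₁ M₂ + R)
    (by
      intro t ht x
      refine (abs_sub _ _).trans (add_le_add (le_trans ?_ (le_max_left _ _)) ?_)
      · exact hM₁ t ht _ (δ₁R t ht _) _ (δ₂R t ht _) _ (qR _) _ (qR _)
      · exact abs_le.2 (δ₁R t ht _))
    (by
      intro t ht x
      refine (abs_sub _ _).trans (add_le_add (le_trans ?_ (le_max_right _ _)) ?_)
      · exact hM₂ t ht _ (δ₁R t ht _) _ (δ₂R t ht _) _ (qR _) _ (qR _)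
      · exact abs_le.2 (δ₂R t ht _))
  simp only at hzz hww
  -- localization
  have lz : ∀ t ∈ Set.Icc 0 T, a₁ t ≤ z t := by
    refine aux_loc T hT z a₁ hz ca1 pz pdz pa1 (by rw [da1]; exact hda1) ?_
    intro t ht h1 h2
    rw [da1] at h2
    have hq := abs_le.1 (hA₁ t ht)
    rw [hzz t ht, da1, aux_trunc_low h1.le, h2,
      aux_trunc_mem (show -N ≤ deriv α₁ t by linarith) (show deriv α₁ t ≤ N by linarith)]
    have hr := aux_deriv_range T α₁ ha1 t ht
    have hm := hfmono t ht (a₁ t) (deriv α₁ t) (max (-N) (min (deriv w t) N))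
      ((min_le_left _ _).trans hr.1) (hr.2.trans (le_max_left _ _)) _ _ (δ₂r t ht (w t)).1
    have hl := hla1 t ht (max (-N) (min (deriv w t) N))
    linarith
  have uz : ∀ t ∈ Set.Icc 0 T, z t ≤ b₁ t := by
    refine aux_loc_up T hT z b₁ hz cb1 pz pdz pb1 (by rw [db1]; exact hdb1) ?_
    intro t ht h1 h2
    rw [db1] at h2
    have hq := abs_le.1 (hB₁ t ht)
    rw [hzz t ht, db1, aux_trunc_up ((ra1 t ht).2.trans (rb1 t ht).1) h1.le, h2,
      aux_trunc_mem (show -N ≤ deriv β₁ t by linarith) (show deriv β₁ t ≤ N by linarith)]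
    have hr := aux_deriv_range T β₁ hb1 t ht
    have hm := hfmono t ht (b₁ t) (deriv β₁ t) (max (-N) (min (deriv w t) N))
      ((min_le_right _ _).trans hr.1) (hr.2.trans (le_max_right _ _)) _ _ (δ₂r t ht (w t)).2
    have hl := hub1 t ht (max (-N) (min (deriv w t) N))
    linarith
  have lw : ∀ t ∈ Set.Icc 0 T, a₂ t ≤ w t := by
    refine aux_loc T hT w a₂ hw ca2 pw pdw pa2 (by rw [da2]; exact hda2) ?_
    intro t ht h1 h2
    rw [da2] at h2
    have hq := abs_le.1 (hA₂ t ht)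
    rw [hww t ht, da2, aux_trunc_low h1.le, h2,
      aux_trunc_mem (show -N ≤ deriv α₂ t by linarith) (show deriv α₂ t ≤ N by linarith)]
    have hr := aux_deriv_range T α₂ ha2 t ht
    have hm := hgmono t ht (a₂ t) (max (-N) (min (deriv z t) N)) (deriv α₂ t)
      ((min_le_left _ _).trans hr.1) (hr.2.trans (le_max_left _ _)) _ _ (δ₁r t ht (z t)).1
    have hl := hla2 t ht (max (-N) (min (deriv z t) N))
    linarith
  have uw : ∀ t ∈ Set.Icc 0 T, w t ≤ b₂ t := by
    refine aux_loc_up T hT w b₂ hw cb2 pw pdw pb2 (by rw [db2]; exact hdb2) ?_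
    intro t ht h1 h2
    rw [db2] at h2
    have hq := abs_le.1 (hB₂ t ht)
    rw [hww t ht, db2, aux_trunc_up ((ra2 t ht).2.trans (rb2 t ht).1) h1.le, h2,
      aux_trunc_mem (show -N ≤ deriv β₂ t by linarith) (show deriv β₂ t ≤ N by linarith)]
    have hr := aux_deriv_range T β₂ hb2 t ht
    have hm := hgmono t ht (b₂ t) (max (-N) (min (deriv z t) N)) (deriv β₂ t)
      ((min_le_right _ _).trans hr.1) (hr.2.trans (le_max_right _ _)) _ _ (δ₁r t ht (z t)).2
    have hl := hub2 t ht (max (-N) (min (deriv z t) N))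
    linarith
  -- removal of the truncations in the positions
  have ez : ∀ t ∈ Set.Icc 0 T, deriv (deriv z) t =
      f t (z t) (w t) (max (-N) (min (deriv z t) N)) (max (-N) (min (deriv w t) N)) := by
    intro t ht
    rw [hzz t ht, aux_trunc_mem (lz t ht) (uz t ht), aux_trunc_mem (lw t ht) (uw t ht)]
    ring
  have ew : ∀ t ∈ Set.Icc 0 T, deriv (deriv w) t =
      g t (z t) (w t) (max (-N) (min (deriv z t) N)) (max (-N) (min (deriv w t) N)) := by
    intro t ht
    rw [hww t ht, aux_trunc_mem (lz t ht) (uz t ht), aux_trunc_mem (lw t ht) (uw t ht)]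
    ring
  -- derivative bounds
  have bz := aux_nagumo T hT φ hφc hφp N hN0 big₁ z hz pz (fun t ht => by
    rw [ez t ht]
    exact (hN t ht _ _ _ _ (lz t ht) (uz t ht) (lw t ht) (uw t ht)).1)
  have bw := aux_nagumo T hT ψ hψc hψp N hN0 big₂ w hw pw (fun t ht => by
    rw [ew t ht]
    exact (hN t ht _ _ _ _ (lz t ht) (uz t ht) (lw t ht) (uw t ht)).2)
  refine ⟨z, w, hz, hw, ?_, ?_, ⟨pz, pdz, pw, pdw⟩,
    fun t ht => ⟨lz t ht, uz t ht, lw t ht, uw t ht⟩⟩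
  · intro t ht
    rw [ez t ht, aux_trunc_mem (bz t ht).1 (bz t ht).2, aux_trunc_mem (bw t ht).1 (bw t ht).2]
  · intro t ht
    rw [ew t ht, aux_trunc_mem (bz t ht).1 (bz t ht).2, aux_trunc_mem (bw t ht).1 (bw t ht).2]
end

section
/- Under the hypotheses of the main theorem (lower and upper solutions (α₁,α₂),(β₁,β₂) of (OP),(PBC); Nagumo-type condition of f,g relative to [α₁⁰,β₁⁰],[α₂⁰,β₂⁰]; f non-increasing in w₀; g non-increasing in z₀), the auxiliary problem (AP) with λ=μ=1, i.e. z''(t)−z(t)=f(t,δ₁(t,z(t)),δ₂(t,w(t)),z'(t),w'(t))−δ₁(t,z(t)) and w''(t)−w(t)=g(t,δ₁(t,z(t)),δ₂(t,w(t)),z'(t),w'(t))−δ₂(t,w(t)) on [0,T] together with the periodic boundary conditions (PBC), has at least one solution (z,w)∈(C²[0,T])². -/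
/-- The truncation operator `δ` associated with lower bound `lo` and upper
bound `hi`. -/
noncomputable def trunc (lo hi : ℝ → ℝ) (t x : ℝ) : ℝ :=
  if hi t < x then hi t else if x < lo t then lo t else x

/-- `(z,w)` is a solution of the truncated, perturbed, homotopic auxiliary
problem (AP) with parameters `lam, mu`, associated with lower solutions
`(α₁, α₂)` and upper solutions `(β₁, β₂)`. -/
noncomputable def IsAPSolution (T : ℝ) (f g : ℝ → ℝ → ℝ → ℝ → ℝ → ℝ)
    (α₁ α₂ β₁ β₂ : ℝ → ℝ) (lam mu : ℝ) (z w : ℝ → ℝ) : Prop :=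
  ContDiff ℝ 2 z ∧ ContDiff ℝ 2 w ∧
  (∀ t ∈ Set.Icc 0 T,
    deriv (deriv z) t - z t =
      lam * f t (trunc (lowShift T α₁) (upShift T β₁) t (z t))
                (trunc (lowShift T α₂) (upShift T β₂) t (w t))
                (deriv z t) (deriv w t)
        - lam * trunc (lowShift T α₁) (upShift T β₁) t (z t)) ∧
  (∀ t ∈ Set.Icc 0 T,
    deriv (deriv w) t - w t =
      mu * g t (trunc (lowShift T α₁) (upShift T β₁) t (z t))
               (trunc (lowShift T α₂) (upShift T β₂) t (w t))
               (deriv z t) (deriv w t)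
        - mu * trunc (lowShift T α₂) (upShift T β₂) t (w t))



section Brouwer
open MeasureTheory Metric Topology

/-- `det (1 + t A)` at `t = 1` from its values at `n + 1` nodes. -/
lemma det_interp {n : ℕ} (s : Finset ℕ) (hs : n < s.card) (v : ℕ → ℝ) (hv : Set.InjOn v s)
    (A : EuclideanSpace ℝ (Fin n) →L[ℝ] EuclideanSpace ℝ (Fin n)) :
    (1 + A).det = ∑ j ∈ s, (1 + v j • A).det * (Lagrange.basis s v j).eval 1 := by
  classical
  let b := (EuclideanSpace.basisFun (Fin n) ℝ).toBasis
  let M := LinearMap.toMatrix b b (A : EuclideanSpace ℝ (Fin n) →ₗ[ℝ] EuclideanSpace ℝ (Fin n))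
  let P : Polynomial ℝ := Matrix.det ((Polynomial.X : Polynomial ℝ) • M.map Polynomial.C
    + (1 : Matrix (Fin n) (Fin n) ℝ).map Polynomial.C)
  have hP : ∀ t : ℝ, P.eval t = (1 + t • A).det := by
    intro t
    have h1 : (1 + t • A).det = Matrix.det (1 + t • M) := by
      rw [ContinuousLinearMap.det, ← LinearMap.det_toMatrix b]
      congr 1
      have : ((1 + t • A : EuclideanSpace ℝ (Fin n) →L[ℝ] EuclideanSpace ℝ (Fin n)) :
          EuclideanSpace ℝ (Fin n) →ₗ[ℝ] EuclideanSpace ℝ (Fin n)) = LinearMap.id + t • (A : EuclideanSpace ℝ (Fin n) →ₗ[ℝ] EuclideanSpace ℝ (Fin n)) := by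
        ext x; simp
      rw [this, map_add, map_smul, LinearMap.toMatrix_id]
    rw [h1, ← Polynomial.coe_evalRingHom, RingHom.map_det]
    congr 1
    ext i j
    simp only [RingHom.mapMatrix_apply, Matrix.map_apply, Matrix.add_apply, Matrix.smul_apply,
      smul_eq_mul, Polynomial.coe_evalRingHom, Polynomial.eval_add, Polynomial.eval_mul,
      Polynomial.eval_X, Polynomial.eval_C]
    ring
  have hdeg : P.degree < s.card := by
    refine lt_of_le_of_lt Polynomial.degree_le_natDegree ?_
    have := Polynomial.natDegree_det_X_add_C_le M 1
    rw [Fintype.card_fin] at this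
    exact_mod_cast lt_of_le_of_lt this hs
  have h1 := hP 1
  rw [one_smul] at h1
  rw [← h1]
  conv_lhs => rw [Lagrange.eq_interpolate hv hdeg]
  rw [Lagrange.interpolate_apply, Polynomial.eval_finsetSum]
  refine Finset.sum_congr rfl fun j _ => ?_
  rw [Polynomial.eval_mul, Polynomial.eval_C, hP]





lemma surj_of_det_ne_zero {n : ℕ} (A : EuclideanSpace ℝ (Fin n) →L[ℝ] EuclideanSpace ℝ (Fin n))
    (hA : A.det ≠ 0) : Function.Surjective A :=
  (LinearMap.equivOfDetNeZero
    (A : EuclideanSpace ℝ (Fin n) →ₗ[ℝ] EuclideanSpace ℝ (Fin n)) hA).surjective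

lemma no_retraction {n : ℕ} (r : EuclideanSpace ℝ (Fin n) → EuclideanSpace ℝ (Fin n))
    (U : Set (EuclideanSpace ℝ (Fin n))) (hU : IsOpen U)
    (hsub : closedBall 0 1 ⊆ U) (hr : ContDiffOn ℝ 1 r U) (hr1 : ∀ x ∈ closedBall 0 1, ‖r x‖ = 1)
    (hrid : ∀ x, ‖x‖ = 1 → r x = x) : False := by
  classical
  let E := EuclideanSpace ℝ (Fin n)
  set B : Set E := closedBall 0 1 with hB
  set O : Set E := ball 0 1 with hO
  have hOB : O ⊆ B := ball_subset_closedBall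
  have hBc : IsCompact B := isCompact_closedBall _ _
  let v : E → E := fun x => r x - x
  have hvC : ContDiffOn ℝ 1 v U := hr.sub contDiffOn_id
  have hvd : ∀ x ∈ B, DifferentiableAt ℝ v x := fun x hx =>
    (hvC.contDiffAt (hU.mem_nhds (hsub hx))).differentiableAt (by norm_num)
  have hvcont : ContinuousOn (fderiv ℝ v) B :=
    (hvC.continuousOn_fderiv_of_isOpen hU le_rfl).mono hsub
  obtain ⟨L, hL⟩ := hBc.exists_bound_of_continuousOn hvcont
  have hL0 : 0 ≤ L := (norm_nonneg _).trans (hL 0 (by simp [hB]))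
  -- determinant positive near 1
  have hdetc : Continuous (fun A : E →L[ℝ] E => A.det) := ContinuousLinearMap.continuous_det
  obtain ⟨d, hd, hdet⟩ : ∃ d > 0, ∀ A : E →L[ℝ] E, ‖A‖ < d → 0 < (1 + A).det := by
    have h1 : ContinuousAt (fun A : E →L[ℝ] E => (1 + A).det) 0 :=
      (hdetc.comp (continuous_const.add continuous_id)).continuousAt
    have h2 : (0:ℝ) < (1 + (0 : E →L[ℝ] E)).det := by
      rw [add_zero]; simp [ContinuousLinearMap.det]
    have := h1.eventually (lt_mem_nhds h2)
    obtain ⟨d, hd, h⟩ := Metric.eventually_nhds_iff.1 this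
    exact ⟨d, hd, fun A hA => h (by simpa using hA)⟩
  obtain ⟨τ, hτ0, hτ1, hτL, hτd⟩ : ∃ τ : ℝ, 0 < τ ∧ τ < 1 ∧ τ * L < 1 ∧ τ * L < d := by
    refine ⟨min (1/2) (min 1 d / (2 * (L + 1))), by positivity, ?_, ?_, ?_⟩
    · exact lt_of_le_of_lt (min_le_left _ _) (by norm_num)
    all_goals
      refine lt_of_le_of_lt (mul_le_mul_of_nonneg_right (min_le_right _ _) hL0) ?_
      have hm : 0 < min 1 d := by positivity
      have : min 1 d / (2 * (L + 1)) * L < min 1 d := by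
        rw [div_mul_eq_mul_div, div_lt_iff₀ (by positivity)]
        nlinarith
    · exact this.trans_le (min_le_left _ _)
    · exact this.trans_le (min_le_right _ _)
  have hlip : ∀ x ∈ B, ∀ y ∈ B, ‖v y - v x‖ ≤ L * ‖y - x‖ := fun x hx y hy =>
    (convex_closedBall (0:E) 1).norm_image_sub_le_of_norm_fderiv_le hvd hL hx hy
  -- the key volume identity
  have key : ∀ t : ℝ, 0 ≤ t → t ≤ τ →
      ∫ x in O, (1 + t • fderiv ℝ v x).det = volume.real O := by
    intro t ht0 htτ
    have htL : t * L < 1 := lt_of_le_of_lt (mul_le_mul_of_nonneg_right htτ hL0) hτL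
    let g : E → E := fun x => x + t • v x
    have hgd : ∀ x ∈ B, HasStrictFDerivAt g (1 + t • fderiv ℝ v x) x := by
      intro x hx
      have h1 : HasStrictFDerivAt v (fderiv ℝ v x) x :=
        (hvC.contDiffAt (hU.mem_nhds (hsub hx))).hasStrictFDerivAt (by norm_num)
      exact (hasStrictFDerivAt_id x).add (h1.const_smul t)
    have hpos : ∀ x ∈ B, 0 < (1 + t • fderiv ℝ v x).det := by
      intro x hx
      apply hdet
      rw [norm_smul, Real.norm_of_nonneg ht0]
      exact lt_of_le_of_lt (mul_le_mul htτ (hL x hx) (norm_nonneg _) hτ0.le) hτd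
    have hinj : Set.InjOn g B := by
      intro x hx y hy hxy
      have h1 : y - x = -(t • (v y - v x)) := by
        have : x + t • v x = y + t • v y := hxy
        rw [smul_sub, neg_sub, sub_eq_sub_iff_add_eq_add, ← this]; abel
      have h2 : ‖y - x‖ ≤ t * (L * ‖y - x‖) := by
        conv_lhs => rw [h1]
        rw [norm_neg, norm_smul, Real.norm_of_nonneg ht0]
        exact mul_le_mul_of_nonneg_left (hlip x hx y hy) ht0
      have h3 : ‖y - x‖ = 0 := by
        nlinarith [norm_nonneg (y - x)]
      rw [norm_eq_zero, sub_eq_zero] at h3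
      exact h3.symm
    have hgO : g '' O ⊆ O := by
      rintro _ ⟨x, hx, rfl⟩
      have hx1 : ‖x‖ < 1 := by simpa [hO] using hx
      have h1 : g x = (1 - t) • x + t • r x := by
        simp only [g, v, smul_sub, sub_smul, one_smul]; abel
      have h2 : ‖g x‖ < 1 := by
        rw [h1]
        have ht1 : t < 1 := lt_of_le_of_lt htτ hτ1
        calc _ ≤ ‖(1 - t) • x‖ + ‖t • r x‖ := norm_add_le _ _
          _ = (1 - t) * ‖x‖ + t * 1 := by
            rw [norm_smul, norm_smul, Real.norm_of_nonneg ht0, Real.norm_of_nonneg (by linarith), hr1 x (hOB hx)]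
          _ < 1 := by nlinarith
      simpa [hO] using h2
    have hgopen : IsOpen (g '' O) := by
      rw [isOpen_iff_mem_nhds]
      rintro _ ⟨x, hx, rfl⟩
      have hne : (1 + t • fderiv ℝ v x).det ≠ 0 := (hpos x (hOB hx)).ne'
      have hrange : (1 + t • fderiv ℝ v x).range = ⊤ := by
        have := LinearMap.range_eq_top.2 (surj_of_det_ne_zero _ hne)
        exact this
      rw [← (hgd x (hOB hx)).map_nhds_eq_of_surj hrange]
      exact Filter.image_mem_map (isOpen_ball.mem_nhds hx)
    have hgcont : ContinuousOn g B := fun x hx =>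
      (hgd x hx).hasFDerivAt.continuousAt.continuousWithinAt
    have hgsurj : O ⊆ g '' O := by
      refine (convex_ball (0:E) 1).isPreconnected.subset_of_closure_inter_subset hgopen
        ⟨g 0, hgO ⟨0, by simp [hO], rfl⟩, 0, by simp [hO], rfl⟩ ?_
      rintro y ⟨hy, hyO⟩
      have h1 : closure (g '' O) ⊆ g '' B :=
        closure_minimal (Set.image_mono hOB) (hBc.image_of_continuousOn hgcont).isClosed
      obtain ⟨x, hx, rfl⟩ := h1 hy
      refine ⟨x, ?_, rfl⟩
      by_contra hxO
      have hx1 : ‖x‖ = 1 := by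
        have a1 : ‖x‖ ≤ 1 := by simpa [hB] using hx
        have a2 : ¬ ‖x‖ < 1 := by simpa [hO] using hxO
        linarith
      have : g x = x := by simp [g, v, hrid x hx1]
      rw [this] at hyO
      exact hxO hyO
    have himg : g '' O = O := hgO.antisymm hgsurj
    have hcv := integral_image_eq_integral_abs_det_fderiv_smul (volume : Measure E)
      (measurableSet_ball : MeasurableSet O)
      (fun x hx => (hgd x (hOB hx)).hasFDerivAt.hasFDerivWithinAt) (hinj.mono hOB)
      (fun _ => (1:ℝ))
    rw [himg] at hcv
    simp only [smul_eq_mul, mul_one] at hcv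
    rw [setIntegral_const, smul_eq_mul, mul_one] at hcv
    rw [hcv]
    refine setIntegral_congr_fun measurableSet_ball fun x hx => ?_
    exact (abs_of_pos (hpos x (hOB hx))).symm
  -- interpolation
  let s := Finset.range (n + 1)
  let w : ℕ → ℝ := fun j => τ * j / (n + 1)
  have hw : Set.InjOn w s := by
    intro i _ j _ hij
    have hn : (n:ℝ) + 1 ≠ 0 := by positivity
    simp only [w] at hij
    field_simp at hij
    exact_mod_cast hij
  have hw0 : ∀ j, 0 ≤ w j := fun j => by positivity
  have hw1 : ∀ j ∈ s, w j ≤ τ := by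
    intro j hj
    simp only [w]
    rw [div_le_iff₀ (by positivity)]
    have : (j:ℝ) ≤ n + 1 := by exact_mod_cast (Finset.mem_range.1 hj).le
    nlinarith
  have hdet1 : ∀ x, (1 + fderiv ℝ v x).det
      = ∑ j ∈ s, (1 + w j • fderiv ℝ v x).det * (Lagrange.basis s w j).eval 1 := fun x =>
    det_interp s (by simp [s]) w hw _
  have h_integ : ∀ t : ℝ, IntegrableOn (fun x => (1 + t • fderiv ℝ v x).det) O := by
    intro t
    have : ContinuousOn (fun x => (1 + t • fderiv ℝ v x).det) B :=
      hdetc.comp_continuousOn (continuousOn_const.add (hvcont.const_smul t))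
    exact (this.integrableOn_compact hBc).mono_set hOB
  have hI : ∫ x in O, (1 + fderiv ℝ v x).det = volume.real O := by
    simp_rw [hdet1]
    rw [integral_finsetSum _ (fun j _ => (h_integ (w j)).mul_const _)]
    simp_rw [integral_mul_const]
    rw [Finset.sum_congr rfl (fun j hj => by rw [key (w j) (hw0 j) (hw1 j hj)]),
      ← Finset.mul_sum, ← Polynomial.eval_finsetSum, Lagrange.sum_basis hw ⟨0, by simp [s]⟩]
    simp
  have hzero : ∀ x ∈ O, (1 + fderiv ℝ v x).det = 0 := by
    intro x hx
    have hrd : HasFDerivAt r (1 + fderiv ℝ v x) x := by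
      have h1 := (hasFDerivAt_id (𝕜 := ℝ) x).add (hvd x (hOB hx)).hasFDerivAt
      refine h1.congr_of_eventuallyEq (Filter.Eventually.of_forall fun y => ?_)
      simp [v]
    by_contra hne
    obtain ⟨u, hu⟩ := surj_of_det_ne_zero _ hne (r x)
    have hu' : (1 + fderiv ℝ v x) u = r x := hu
    have h2 : HasFDerivAt (fun y => inner ℝ (r y) (r y)) _ x := hrd.inner ℝ hrd
    have h3 : HasFDerivAt (fun y => inner ℝ (r y) (r y)) (0 : E →L[ℝ] ℝ) x := by
      refine (hasFDerivAt_const (1:ℝ) x).congr_of_eventuallyEq ?_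
      filter_upwards [isOpen_ball.mem_nhds hx] with y hy
      rw [real_inner_self_eq_norm_sq, hr1 y (hOB hy)]; norm_num
    have h4 := congrArg (fun A : E →L[ℝ] ℝ => A u) (h2.unique h3)
    have h5 : inner ℝ (r x) (r x) = (1:ℝ) := by
      rw [real_inner_self_eq_norm_sq, hr1 x (hOB hx)]; norm_num
    simp [fderivInnerCLM_apply] at h4
    simp at hu'
    rw [hu', ] at h4
    rw [real_inner_self_eq_norm_sq, hr1 x (hOB hx)] at h4
    norm_num at h4
  rw [setIntegral_congr_fun measurableSet_ball hzero] at hI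
  simp only [integral_zero] at hI
  have : 0 < volume.real O := by
    refine ENNReal.toReal_pos (measure_ball_pos _ _ one_pos).ne' measure_ball_lt_top.ne
  linarith


theorem brouwer_aux {n : ℕ} (F : EuclideanSpace ℝ (Fin n) → EuclideanSpace ℝ (Fin n))
    (hF : Continuous F) (hb : ∀ x, ‖F x‖ ≤ 1 / 2) : ∃ x, F x = x := by
  by_contra! hne
  let E := EuclideanSpace ℝ (Fin n)
  have hBc : IsCompact (closedBall (0:E) 1) := isCompact_closedBall _ _
  obtain ⟨x0, hx0, hmin⟩ := hBc.exists_isMinOn ⟨0, by simp⟩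
    (hF.sub continuous_id).norm.continuousOn
  set e := ‖F x0 - x0‖ with he
  have he0 : 0 < e := norm_pos_iff.2 (sub_ne_zero.2 (hne x0))
  obtain ⟨p, hp, hpF, -⟩ := hF.exists_contDiff_approx 1 (ε := fun _ => min e (1/2))
    continuous_const (fun _ => by positivity)
  have hp1 : ∀ x, ‖p x‖ < 1 := by
    intro x
    have h1 : dist (p x) (F x) < 1 / 2 := (hpF x).trans_le (min_le_right _ _)
    rw [dist_eq_norm] at h1
    have h2 := norm_add_le (p x - F x) (F x)
    rw [sub_add_cancel] at h2
    linarith [hb x]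
  have hpne : ∀ x ∈ closedBall (0:E) 1, x - p x ≠ 0 := by
    intro x hx h
    have h1 : dist (p x) (F x) < e := (hpF x).trans_le (min_le_left _ _)
    have h2 : e ≤ ‖F x - x‖ := hmin hx
    rw [sub_eq_zero] at h
    rw [← h, dist_comm, dist_eq_norm] at h1
    linarith
  let u : E → E := fun x => x - p x
  have hu : ContDiff ℝ 1 u := contDiff_id.sub hp
  let a : E → ℝ := fun x => inner ℝ (u x) (u x)
  let b : E → ℝ := fun x => inner ℝ x (u x)
  let D : E → ℝ := fun x => b x ^ 2 + a x * (1 - inner ℝ x x)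
  have ha : ContDiff ℝ 1 a := hu.inner ℝ hu
  have hbb : ContDiff ℝ 1 b := contDiff_id.inner ℝ hu
  have hD : ContDiff ℝ 1 D := (hbb.pow 2).add (ha.mul (contDiff_const.sub (contDiff_id.inner ℝ contDiff_id)))
  let U : Set E := {x | 0 < D x}
  have hUo : IsOpen U := isOpen_lt continuous_const hD.continuous
  have hane : ∀ x ∈ U, a x ≠ 0 := by
    intro x hx h
    have h1 : u x = 0 := inner_self_eq_zero.1 h
    have h2 : 0 < D x := hx
    simp [D, b, h, h1] at h2
  have hbpos : ∀ x : E, ‖x‖ = 1 → 0 < b x := by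
    intro x hx
    have h1 : b x = inner ℝ x x - inner ℝ x (p x) := inner_sub_right _ _ _
    rw [h1, real_inner_self_eq_norm_sq, hx]
    have := real_inner_le_norm x (p x)
    rw [hx] at this
    linarith [hp1 x]
  have hsub : closedBall (0:E) 1 ⊆ U := by
    intro x hx
    have hx1 : ‖x‖ ≤ 1 := by simpa using hx
    have hapos : 0 < a x := by
      have : u x ≠ 0 := hpne x hx
      exact real_inner_self_pos.2 this
    show 0 < b x ^ 2 + a x * (1 - inner ℝ x x)
    rw [real_inner_self_eq_norm_sq]
    rcases hx1.lt_or_eq with h | h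
    · have : 0 < 1 - ‖x‖ ^ 2 := by nlinarith [norm_nonneg x]
      positivity
    · have := hbpos x h
      rw [h]; norm_num; positivity
  let s : E → ℝ := fun x => (-b x + √(D x)) / a x
  have hs : ContDiffOn ℝ 1 s U := by
    refine ContDiffOn.div ?_ ha.contDiffOn hane
    refine hbb.neg.contDiffOn.add ?_
    exact hD.contDiffOn.sqrt (fun x hx => (show 0 < D x from hx).ne')
  refine no_retraction (fun x => x + s x • u x) U hUo hsub
    (contDiffOn_id.add (hs.smul hu.contDiffOn)) ?_ ?_
  · intro x hx
    have hxU := hsub hx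
    have hDx : 0 < D x := hxU
    have h1 : ‖x + s x • u x‖ ^ 2 = 1 := by
      rw [← real_inner_self_eq_norm_sq, inner_add_left, inner_add_right, inner_add_right,
        real_inner_smul_left, real_inner_smul_left, real_inner_smul_right, real_inner_smul_right,
        real_inner_comm x (u x)]
      have hsa : s x * a x = -b x + √(D x) := div_mul_cancel₀ _ (hane x hxU)
      have hsq : √(D x) ^ 2 = D x := Real.sq_sqrt hDx.le
      have h3 : √(D x) = s x * a x + b x := by linarith
      rw [h3] at hsq
      have h4 : a x * (inner ℝ x x + s x * b x + (s x * b x + s x * (s x * a x)) - 1) = 0 := by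
        have : D x = b x ^ 2 + a x * (1 - inner ℝ x x) := rfl
        rw [this] at hsq
        linarith
      have h5 := (mul_eq_zero.1 h4).resolve_left (hane x hxU)
      show inner ℝ x x + s x * b x + (s x * b x + s x * (s x * a x)) = 1
      linarith
    have h2 : (‖x + s x • u x‖ - 1) * (‖x + s x • u x‖ + 1) = 0 := by ring_nf; linarith
    rcases mul_eq_zero.1 h2 with h | h
    · linarith
    · linarith [norm_nonneg (x + s x • u x)]
  · intro x hx
    have hb0 := hbpos x hx
    have : D x = b x ^ 2 := by
      show b x ^ 2 + a x * (1 - inner ℝ x x) = _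
      rw [real_inner_self_eq_norm_sq, hx]; ring
    have hs0 : s x = 0 := by
      show (-b x + √(D x)) / a x = 0
      rw [this, Real.sqrt_sq hb0.le]; simp
    show x + s x • u x = x
    rw [hs0]; simp

theorem brouwer_bounded {n : ℕ} (F : EuclideanSpace ℝ (Fin n) → EuclideanSpace ℝ (Fin n))
    (hF : Continuous F) (R : ℝ) (hb : ∀ x, ‖F x‖ ≤ R) : ∃ x, F x = x := by
  have hR : 0 ≤ R := (norm_nonneg _).trans (hb 0)
  set c : ℝ := 2 * (R + 1) with hc
  have hc0 : 0 < c := by positivity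
  obtain ⟨x, hx⟩ := brouwer_aux (fun x => c⁻¹ • F (c • x))
    (by fun_prop) (fun x => by
      rw [norm_smul, norm_inv, Real.norm_of_nonneg hc0.le, inv_mul_le_iff₀ hc0]
      have := hb (c • x)
      rw [hc]; linarith)
  refine ⟨c • x, ?_⟩
  conv_rhs => rw [← hx]
  rw [smul_inv_smul₀ hc0.ne']

/-- Schauder fixed point theorem for a map of a normed space with relatively compact range. -/
theorem schauder {X : Type*} [NormedAddCommGroup X] [NormedSpace ℝ X] (A : X → X)
    (hA : Continuous A) (C : Set X) (hC : IsCompact C) (hAC : ∀ x, A x ∈ C) : ∃ x, A x = x := by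
  have happrox : ∀ ε : ℝ, 0 < ε → ∃ x, ‖A x - x‖ ≤ ε := by
    intro ε hε
    obtain ⟨t, -, htf, hcov⟩ := hC.finite_cover_balls hε
    obtain ⟨n, y, hy⟩ : ∃ (n : ℕ) (y : Fin n → X), ∀ c ∈ C, ∃ i, dist c (y i) < ε := by
      have := htf.fintype
      refine ⟨Fintype.card t, fun i => ((Fintype.equivFin t).symm i : X), fun c hc => ?_⟩
      have := hcov hc
      simp only [Set.mem_iUnion, mem_ball] at this
      obtain ⟨x, hx, hd⟩ := this
      exact ⟨Fintype.equivFin t ⟨x, hx⟩, by simpa using hd⟩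
    let μ : Fin n → X → ℝ := fun i c => max 0 (ε - dist c (y i))
    have hμ0 : ∀ i c, 0 ≤ μ i c := fun i c => le_max_left _ _
    have hμc : ∀ i, Continuous (μ i) := fun i => by fun_prop
    let S : X → ℝ := fun c => ∑ i, μ i c
    have hS : ∀ c ∈ C, 0 < S c := by
      intro c hc
      obtain ⟨i, hi⟩ := hy c hc
      refine Finset.sum_pos' (fun i _ => hμ0 i c) ⟨i, Finset.mem_univ _, ?_⟩
      exact lt_max_of_lt_right (by linarith)
    have hSc : Continuous S := continuous_finsetSum _ fun i _ => hμc i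
    let q : EuclideanSpace ℝ (Fin n) → X := fun s => ∑ i, s i • y i
    have hq : Continuous q := by fun_prop
    let F : EuclideanSpace ℝ (Fin n) → EuclideanSpace ℝ (Fin n) := fun s =>
      WithLp.toLp 2 (fun i => μ i (A (q s)) / S (A (q s)))
    have hF : Continuous F := by
      refine (PiLp.continuous_toLp 2 _).comp (continuous_pi fun i => ?_)
      exact ((hμc i).comp (hA.comp hq)).div (hSc.comp (hA.comp hq))
        (fun s => (hS _ (hAC _)).ne')
    have hFb : ∀ s, ‖F s‖ ≤ √n := by
      intro s
      rw [EuclideanSpace.norm_eq]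
      apply Real.sqrt_le_sqrt
      calc ∑ i, ‖F s i‖ ^ 2 ≤ ∑ i : Fin n, (1:ℝ) := by
            refine Finset.sum_le_sum fun i _ => ?_
            have h1 : F s i = μ i (A (q s)) / S (A (q s)) := rfl
            have h2 := hS _ (hAC (q s))
            have h3 : 0 ≤ F s i := by rw [h1]; exact div_nonneg (hμ0 _ _) h2.le
            have h4 : F s i ≤ 1 := by
              rw [h1, div_le_one h2]
              exact Finset.single_le_sum (f := fun i => μ i (A (q s))) (fun i _ => hμ0 i _) (Finset.mem_univ i)
            rw [Real.norm_of_nonneg h3]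
            exact pow_le_one₀ h3 h4
        _ = n := by simp
    obtain ⟨s, hs⟩ := brouwer_bounded F hF _ hFb
    refine ⟨q s, ?_⟩
    set c := A (q s) with hc
    have hSp := hS c (hAC _)
    have h1 : S c • (c - q s) = ∑ i, μ i c • (c - y i) := by
      have h2 : ∀ i, s i = μ i c / S c := fun i => by
        conv_lhs => rw [← hs]
      have h3 : S c • q s = ∑ i, μ i c • y i := by
        simp only [q, Finset.smul_sum]
        refine Finset.sum_congr rfl fun i _ => ?_
        rw [h2, smul_smul, mul_div_cancel₀ _ hSp.ne']
      rw [smul_sub, h3]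
      simp only [smul_sub, Finset.sum_sub_distrib, S, Finset.sum_smul]
    have h4 : ‖S c • (c - q s)‖ ≤ S c * ε := by
      rw [h1]
      refine (norm_sum_le _ _).trans ?_
      simp only [S, Finset.sum_mul]
      refine Finset.sum_le_sum fun i _ => ?_
      rw [norm_smul, Real.norm_of_nonneg (hμ0 _ _)]
      by_cases hd : dist c (y i) ≤ ε
      · exact mul_le_mul_of_nonneg_left (by rwa [← dist_eq_norm]) (hμ0 _ _)
      · have : μ i c = 0 := max_eq_left (by linarith)
        simp [this]
    rw [norm_smul, Real.norm_of_nonneg hSp.le] at h4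
    exact le_of_mul_le_mul_left h4 hSp
  choose x hx using fun k : ℕ => happrox (1 / ((k:ℝ) + 1)) (by positivity)
  obtain ⟨y, -, φ, hφ, hlim⟩ := hC.tendsto_subseq (fun k => hAC (x k))
  have h0 : Filter.Tendsto (fun k => A (x (φ k)) - x (φ k)) Filter.atTop (𝓝 0) := by
    rw [tendsto_zero_iff_norm_tendsto_zero]
    refine squeeze_zero (fun _ => norm_nonneg _) (fun k => hx (φ k)) ?_
    exact tendsto_one_div_add_atTop_nhds_zero_nat.comp hφ.tendsto_atTop
  have h1 : Filter.Tendsto (fun k => x (φ k)) Filter.atTop (𝓝 y) := by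
    have := hlim.sub h0
    simpa using this
  exact ⟨y, tendsto_nhds_unique ((hA.tendsto y).comp h1) hlim⟩

end Brouwer

section Periodic
open Set Topology

/-- The periodic solution of `x' = c x + h`. -/
noncomputable def perSol (T c : ℝ) (h : ℝ → ℝ) (t : ℝ) : ℝ :=
  Real.exp (c * t) * (Real.exp (c * T) / (1 - Real.exp (c * T)) *
    (∫ s in (0:ℝ)..T, Real.exp (-c * s) * h s) + ∫ s in (0:ℝ)..t, Real.exp (-c * s) * h s)

lemma perSol_hasDerivAt (T c : ℝ) (h : ℝ → ℝ) (hh : Continuous h) (t : ℝ) :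
    HasDerivAt (perSol T c h) (c * perSol T c h t + h t) t := by
  have h1 : HasDerivAt (fun t => Real.exp (c * t)) (Real.exp (c * t) * c) t := by
    simpa using ((hasDerivAt_id t).const_mul c).exp
  have hc : Continuous (fun s => Real.exp (-c * s) * h s) := by fun_prop
  have h2 : HasDerivAt (fun t => ∫ s in (0:ℝ)..t, Real.exp (-c * s) * h s)
      (Real.exp (-c * t) * h t) t := hc.integral_hasStrictDerivAt 0 t |>.hasDerivAt
  have h3 := h1.mul (h2.const_add (Real.exp (c * T) / (1 - Real.exp (c * T)) *
    (∫ s in (0:ℝ)..T, Real.exp (-c * s) * h s)))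
  refine h3.congr_deriv ?_
  have h4 : Real.exp (c * t) * Real.exp (-c * t) = 1 := by
    rw [← Real.exp_add]; simp
  unfold perSol
  linear_combination (h t) * h4

lemma perSol_periodic (T c : ℝ) (hT : 0 < T) (hc : c ≠ 0) (h : ℝ → ℝ) :
    perSol T c h 0 = perSol T c h T := by
  have h1 : (1 : ℝ) - Real.exp (c * T) ≠ 0 := by
    rw [sub_ne_zero, ne_comm, Ne, Real.exp_eq_one_iff]
    exact mul_ne_zero hc hT.ne'
  unfold perSol
  rw [intervalIntegral.integral_same, mul_zero, Real.exp_zero]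
  field_simp
  ring

lemma perSol_bound (T c M : ℝ) (hT : 0 < T) :
    ∃ K : ℝ, 0 ≤ K ∧ ∀ h : ℝ → ℝ, (∀ t, |h t| ≤ M) → ∀ t ∈ Icc 0 T, |perSol T c h t| ≤ K := by
  set e := Real.exp (|c| * T)
  set k := |Real.exp (c * T) / (1 - Real.exp (c * T))|
  refine ⟨e * (k * (e * |M| * T) + e * |M| * T), by positivity, fun h hh t ht => ?_⟩
  have he : ∀ d, |d| = |c| → ∀ s ∈ Icc 0 T, Real.exp (d * s) ≤ e := by
    intro d hd s hs
    apply Real.exp_le_exp.2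
    calc d * s ≤ |d| * s := mul_le_mul_of_nonneg_right (le_abs_self d) hs.1
      _ ≤ |c| * T := by rw [hd]; exact mul_le_mul_of_nonneg_left hs.2 (abs_nonneg c)
  have hI : ∀ t ∈ Icc 0 T, |∫ s in (0:ℝ)..t, Real.exp (-c * s) * h s| ≤ e * |M| * T := by
    intro t ht
    have := intervalIntegral.norm_integral_le_of_norm_le_const (a := 0) (b := t)
      (f := fun s => Real.exp (-c * s) * h s) (C := e * |M|) (fun s hs => by
        rw [uIoc_of_le ht.1] at hs
        rw [norm_mul, Real.norm_of_nonneg (Real.exp_pos _).le]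
        exact mul_le_mul (he (-c) (abs_neg c) s ⟨hs.1.le, hs.2.trans ht.2⟩)
          ((hh s).trans (le_abs_self M)) (norm_nonneg _) (Real.exp_pos _).le)
    rw [Real.norm_eq_abs, sub_zero, abs_of_nonneg ht.1] at this
    exact this.trans (mul_le_mul_of_nonneg_left ht.2 (by positivity))
  unfold perSol
  rw [abs_mul, abs_of_pos (Real.exp_pos _)]
  refine mul_le_mul (he c rfl t ht) ?_ (abs_nonneg _) (Real.exp_pos _).le
  refine (abs_add_le _ _).trans (add_le_add ?_ (hI t ht))
  rw [abs_mul]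
  exact mul_le_mul_of_nonneg_left (hI T ⟨hT.le, le_rfl⟩) (abs_nonneg _)

lemma lip_compact (T : ℝ) (K L : ℝ) :
    ∃ C : Set C(Icc (0:ℝ) T, Fin 4 → ℝ), IsCompact C ∧ ∀ f : C(Icc (0:ℝ) T, Fin 4 → ℝ),
      (∀ t, ‖f t‖ ≤ K) → (∀ t s, dist (f t) (f s) ≤ L * dist t s) → f ∈ C := by
  let A : Set (BoundedContinuousFunction (Icc (0:ℝ) T) (Fin 4 → ℝ)) :=
    {f | (∀ t, ‖f t‖ ≤ K) ∧ ∀ t s, dist (f t) (f s) ≤ L * dist t s}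
  have hA : IsCompact A := by
    refine BoundedContinuousFunction.arzela_ascoli₂ (Metric.closedBall 0 K)
      (isCompact_closedBall _ _) A ?_ ?_ ?_
    · refine IsClosed.and ?_ ?_
      · simp only [ofPred_forall]
        exact isClosed_iInter fun t => isClosed_le
          (continuous_eval_const t).norm continuous_const
      · simp only [ofPred_forall]
        exact isClosed_iInter fun t => isClosed_iInter fun s => isClosed_le
          ((continuous_eval_const t).dist
            (continuous_eval_const s)) continuous_const
    · intro f t hf
      simpa using hf.1 t
    · refine Metric.equicontinuous_of_continuity_modulus (fun d => L * d) ?_ _ ?_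
      · have : Continuous (fun d : ℝ => L * d) := by fun_prop
        simpa using this.tendsto 0
      · intro t s f
        exact f.2.2 t s
  refine ⟨_, hA.image (ContinuousMap.isometryEquivBoundedOfCompact (Icc (0:ℝ) T)
    (Fin 4 → ℝ)).symm.continuous, fun f h1 h2 => ?_⟩
  exact ⟨BoundedContinuousFunction.mkOfCompact f, ⟨h1, h2⟩, by ext; rfl⟩

theorem periodic_system (T : ℝ) (hT : 0 < T) (c : Fin 4 → ℝ) (hc : ∀ i, c i ≠ 0)
    (H : ℝ → (Fin 4 → ℝ) → Fin 4 → ℝ) (hH : Continuous (Function.uncurry H)) (M : ℝ)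
    (hM : ∀ t x i, |H t x i| ≤ M) :
    ∃ (ξ x : ℝ → Fin 4 → ℝ), Continuous ξ ∧
      (∀ i t, HasDerivAt (fun t => x t i) (c i * x t i + H t (ξ t) i) t) ∧ x 0 = x T ∧
      ∀ t ∈ Icc 0 T, ξ t = x t := by
  let X := C(Icc (0:ℝ) T, Fin 4 → ℝ)
  let ext : X → ℝ → Fin 4 → ℝ := fun f t => f (projIcc 0 T hT.le t)
  have hext : Continuous (fun p : X × ℝ => ext p.1 p.2) := by
    have : Continuous (fun p : X × Icc (0:ℝ) T => p.1 p.2) := continuous_eval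
    exact this.comp (continuous_fst.prodMk ((continuous_projIcc (h := hT.le)).comp continuous_snd))
  let y : X → ℝ → Fin 4 → ℝ := fun f t i => perSol T (c i) (fun s => H s (ext f s) i) t
  have hHc : ∀ f i, Continuous (fun s => H s (ext f s) i) := by
    intro f i
    have h1 : Continuous (fun s => ext f s) := hext.comp (continuous_const.prodMk continuous_id)
    exact (continuous_apply i).comp (hH.comp (continuous_id.prodMk h1))
  have hder : ∀ f i t, HasDerivAt (fun t => y f t i) (c i * y f t i + H t (ext f t) i) t :=
    fun f i t => perSol_hasDerivAt T (c i) _ (hHc f i) t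
  have hyc : Continuous (fun p : X × ℝ => y p.1 p.2) := by
    refine continuous_pi fun i => ?_
    have h0 : ∀ d : ℝ, Continuous (Function.uncurry fun (p : X × ℝ) (s : ℝ) =>
        Real.exp (d * s) * H s (ext p.1 s) i) := by
      intro d
      have h1 : Continuous (fun q : (X × ℝ) × ℝ => ext q.1.1 q.2) :=
        hext.comp ((continuous_fst.comp continuous_fst).prodMk continuous_snd)
      have h2 : Continuous (fun q : (X × ℝ) × ℝ => H q.2 (ext q.1.1 q.2) i) :=
        (continuous_apply i).comp (hH.comp (continuous_snd.prodMk h1))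
      have h3 : Continuous (fun q : (X × ℝ) × ℝ => Real.exp (d * q.2)) := by fun_prop
      exact h3.mul h2
    have h4 : Continuous fun p : X × ℝ => ∫ s in (0:ℝ)..T, Real.exp (-c i * s) * H s (ext p.1 s) i :=
      intervalIntegral.continuous_parametric_intervalIntegral_of_continuous (h0 (-c i))
        continuous_const
    have h5 : Continuous fun p : X × ℝ => ∫ s in (0:ℝ)..p.2, Real.exp (-c i * s) * H s (ext p.1 s) i :=
      intervalIntegral.continuous_parametric_intervalIntegral_of_continuous (h0 (-c i))
        continuous_snd
    have h6 : Continuous fun p : X × ℝ => Real.exp (c i * p.2) := by fun_prop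
    exact h6.mul ((h4.const_mul _).add h5)
  let A : X → X := fun f => ⟨fun t => y f t, by
    exact hyc.comp (continuous_const.prodMk continuous_subtype_val)⟩
  have hA : Continuous A := by
    refine ContinuousMap.continuous_of_continuous_uncurry _ ?_
    exact hyc.comp (continuous_fst.prodMk (continuous_subtype_val.comp continuous_snd))
  choose K hK0 hK using fun i => perSol_bound T (c i) M hT
  let K' := ∑ i, K i
  have hKK : ∀ i, K i ≤ K' := fun i => Finset.single_le_sum (fun i _ => hK0 i) (Finset.mem_univ i)
  have hK'0 : 0 ≤ K' := (hK0 0).trans (hKK 0)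
  let L := (∑ i, |c i|) * K' + M
  have hM0 : 0 ≤ M := (abs_nonneg _).trans (hM 0 0 0)
  have hL0 : 0 ≤ L := by positivity
  have hyb : ∀ f i, ∀ t ∈ Icc 0 T, |y f t i| ≤ K' := fun f i t ht =>
    (hK i _ (fun t => hM _ _ _) t ht).trans (hKK i)
  obtain ⟨C, hC, hCmem⟩ := lip_compact T K' L
  obtain ⟨f, hf⟩ := schauder A hA C hC (fun f => by
    refine hCmem _ (fun t => ?_) (fun t s => ?_)
    · rw [pi_norm_le_iff_of_nonneg hK'0]
      exact fun i => hyb f i t t.2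
    · rw [dist_pi_le_iff (by positivity)]
      intro i
      have := (convex_Icc (0:ℝ) T).norm_image_sub_le_of_norm_hasDerivWithin_le
        (f := fun t => y f t i) (C := L) (fun x _ => (hder f i x).hasDerivWithinAt)
        (fun x hx => by
          refine (norm_add_le _ _).trans (add_le_add ?_ (hM _ _ _))
          rw [norm_mul]
          refine mul_le_mul ?_ (hyb f i x hx) (norm_nonneg _) (by positivity)
          exact Finset.single_le_sum (f := fun i => |c i|) (fun i _ => abs_nonneg _) (Finset.mem_univ i)) s.2 t.2
      rw [Real.dist_eq, Subtype.dist_eq, Real.dist_eq]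
      exact this)
  refine ⟨ext f, y f, hext.comp (continuous_const.prodMk continuous_id), hder f, ?_, ?_⟩
  · funext i
    exact perSol_periodic T (c i) hT (hc i) _
  · intro t ht
    have h1 : ext f t = f ⟨t, ht⟩ := by simp only [ext, projIcc_of_mem hT.le ht]
    rw [h1]
    conv_lhs => rw [← hf]
    rfl

end Periodic

section SecondOrder
open Set Topology

lemma contDiff_two_of_hasDerivAt (z z1 z2 : ℝ → ℝ) (h1 : ∀ t, HasDerivAt z (z1 t) t)
    (h2 : ∀ t, HasDerivAt z1 (z2 t) t) (hc : Continuous z2) :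
    ContDiff ℝ 2 z ∧ deriv z = z1 ∧ deriv (deriv z) = z2 := by
  have e1 : deriv z = z1 := funext fun t => (h1 t).deriv
  have e2 : deriv z1 = z2 := funext fun t => (h2 t).deriv
  refine ⟨?_, e1, by rw [e1, e2]⟩
  have hz1 : ContDiff ℝ 1 z1 := by
    rw [contDiff_one_iff_deriv, e2]
    exact ⟨fun t => (h2 t).differentiableAt, hc⟩
  have : ContDiff ℝ (1 + 1) z := by
    rw [contDiff_succ_iff_deriv]
    exact ⟨fun t => (h1 t).differentiableAt, by simp, by rwa [e1]⟩
  exact this.of_le (by norm_num)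

theorem second_order_system (T : ℝ) (hT : 0 < T) (h k : ℝ → ℝ → ℝ → ℝ → ℝ → ℝ)
    (hh : Continuous (fun p : ℝ × ℝ × ℝ × ℝ × ℝ => h p.1 p.2.1 p.2.2.1 p.2.2.2.1 p.2.2.2.2))
    (hk : Continuous (fun p : ℝ × ℝ × ℝ × ℝ × ℝ => k p.1 p.2.1 p.2.2.1 p.2.2.2.1 p.2.2.2.2))
    (M : ℝ) (hhM : ∀ t a b c d, |h t a b c d| ≤ M) (hkM : ∀ t a b c d, |k t a b c d| ≤ M) :
    ∃ z w : ℝ → ℝ, ContDiff ℝ 2 z ∧ ContDiff ℝ 2 w ∧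
      (∀ t ∈ Icc 0 T, deriv (deriv z) t = z t + h t (z t) (w t) (deriv z t) (deriv w t)) ∧
      (∀ t ∈ Icc 0 T, deriv (deriv w) t = w t + k t (z t) (w t) (deriv z t) (deriv w t)) ∧
      z 0 = z T ∧ deriv z 0 = deriv z T ∧ w 0 = w T ∧ deriv w 0 = deriv w T := by
  let P : ℝ → (Fin 4 → ℝ) → ℝ × ℝ × ℝ × ℝ × ℝ := fun t x =>
    (t, (x 0 + x 1) / 2, (x 2 + x 3) / 2, (x 0 - x 1) / 2, (x 2 - x 3) / 2)
  have hP : Continuous (Function.uncurry P) := by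
    simp only [P, Function.uncurry_def]; fun_prop
  let h' : ℝ → (Fin 4 → ℝ) → ℝ := fun t x =>
    h t ((x 0 + x 1) / 2) ((x 2 + x 3) / 2) ((x 0 - x 1) / 2) ((x 2 - x 3) / 2)
  let k' : ℝ → (Fin 4 → ℝ) → ℝ := fun t x =>
    k t ((x 0 + x 1) / 2) ((x 2 + x 3) / 2) ((x 0 - x 1) / 2) ((x 2 - x 3) / 2)
  have hh' : Continuous (Function.uncurry h') := hh.comp hP
  have hk' : Continuous (Function.uncurry k') := hk.comp hP
  obtain ⟨ξ, x, hξ, hder, hper, hξx⟩ := periodic_system T hT ![1, -1, 1, -1]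
    (by intro i; fin_cases i <;> simp)
    (fun t x => ![h' t x, -h' t x, k' t x, -k' t x])
    (by
      refine continuous_pi fun i => ?_
      fin_cases i
      · exact hh'
      · exact hh'.neg
      · exact hk'
      · exact hk'.neg) M
    (by
      intro t x i
      fin_cases i
      · exact hhM _ _ _ _ _
      · simpa using hhM _ _ _ _ _
      · exact hkM _ _ _ _ _
      · simpa using hkM _ _ _ _ _)
  have d0 : ∀ t, HasDerivAt (fun t => x t 0) (x t 0 + h' t (ξ t)) t := fun t => by
    simpa using hder 0 t
  have d1 : ∀ t, HasDerivAt (fun t => x t 1) (- x t 1 - h' t (ξ t)) t := fun t => by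
    simpa [sub_eq_add_neg] using hder 1 t
  have d2 : ∀ t, HasDerivAt (fun t => x t 2) (x t 2 + k' t (ξ t)) t := fun t => by
    simpa using hder 2 t
  have d3 : ∀ t, HasDerivAt (fun t => x t 3) (- x t 3 - k' t (ξ t)) t := fun t => by
    simpa [sub_eq_add_neg] using hder 3 t
  have c0 : Continuous fun t => x t 0 := continuous_iff_continuousAt.2 fun t => (d0 t).continuousAt
  have c1 : Continuous fun t => x t 1 := continuous_iff_continuousAt.2 fun t => (d1 t).continuousAt
  have c2 : Continuous fun t => x t 2 := continuous_iff_continuousAt.2 fun t => (d2 t).continuousAt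
  have c3 : Continuous fun t => x t 3 := continuous_iff_continuousAt.2 fun t => (d3 t).continuousAt
  have ch : Continuous fun t => h' t (ξ t) := hh'.comp (continuous_id.prodMk hξ)
  have ck : Continuous fun t => k' t (ξ t) := hk'.comp (continuous_id.prodMk hξ)
  obtain ⟨z2, z1, zz⟩ := contDiff_two_of_hasDerivAt (fun t => (x t 0 + x t 1) / 2)
    (fun t => (x t 0 - x t 1) / 2) (fun t => (x t 0 + x t 1) / 2 + h' t (ξ t))
    (fun t => (((d0 t).add (d1 t)).div_const 2).congr_deriv (by ring))
    (fun t => (((d0 t).sub (d1 t)).div_const 2).congr_deriv (by ring)) (by fun_prop)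
  obtain ⟨w2, w1, ww⟩ := contDiff_two_of_hasDerivAt (fun t => (x t 2 + x t 3) / 2)
    (fun t => (x t 2 - x t 3) / 2) (fun t => (x t 2 + x t 3) / 2 + k' t (ξ t))
    (fun t => (((d2 t).add (d3 t)).div_const 2).congr_deriv (by ring))
    (fun t => (((d2 t).sub (d3 t)).div_const 2).congr_deriv (by ring)) (by fun_prop)
  refine ⟨_, _, z2, w2, ?_, ?_, ?_, ?_, ?_, ?_⟩
  · intro t ht
    rw [zz, z1, w1]
    simp only [hξx t ht]
    rfl
  · intro t ht
    rw [ww, z1, w1]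
    simp only [hξx t ht]
    rfl
  all_goals simp only [z1, w1, hper]

lemma max_principle (T : ℝ) (hT : 0 < T) (u : ℝ → ℝ) (hu : ContDiff ℝ 2 u) (m : ℝ)
    (hp : u 0 = u T) (hd : deriv u T ≤ deriv u 0)
    (h : ∀ t ∈ Icc 0 T, m < u t → deriv u t = 0 → 0 < deriv (deriv u) t) :
    ∀ t ∈ Icc 0 T, u t ≤ m := by
  have hu1 : Differentiable ℝ u := hu.differentiable (by norm_num)
  have hu2 : ContDiff ℝ 1 (deriv u) := by
    have : ContDiff ℝ (1 + 1) u := hu.of_le (by norm_num)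
    exact (contDiff_succ_iff_deriv.1 this).2.2
  have hu3 : Continuous (deriv (deriv u)) := hu2.continuous_deriv le_rfl
  by_contra! hcon
  obtain ⟨s, hs, hsm⟩ := hcon
  obtain ⟨t, ht, htT, hmax⟩ : ∃ t ∈ Icc 0 T, t < T ∧ IsMaxOn u (Icc 0 T) t := by
    obtain ⟨t, ht, hmax⟩ := isCompact_Icc.exists_isMaxOn ⟨s, hs⟩ hu.continuous.continuousOn
    rcases ht.2.lt_or_eq with hlt | heq
    · exact ⟨t, ht, hlt, hmax⟩
    · refine ⟨0, ⟨le_rfl, hT.le⟩, hT, fun y hy => ?_⟩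
      have := hmax hy
      rw [heq] at this
      show u y ≤ u 0
      rw [hp]; exact this
  have hut : m < u t := hsm.trans_le (hmax hs)
  have hright : deriv u t ≤ 0 := by
    by_contra! hpos
    have h1 : ∀ᶠ y in 𝓝[>] t, u t < u y := by
      have := (hu1 t).hasDerivAt.tendsto_slope.mono_left
        (nhdsWithin_mono t (fun y (hy : t < y) => hy.ne'))
      filter_upwards [this.eventually (lt_mem_nhds hpos), self_mem_nhdsWithin] with y hy hty
      rw [slope_def_field] at hy
      have hty' : 0 < y - t := sub_pos.2 hty
      have := (div_pos_iff_of_pos_right hty').1 hy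
      linarith
    have h2 : ∀ᶠ y in 𝓝[>] t, y ∈ Icc 0 T := by
      filter_upwards [Ioo_mem_nhdsGT htT] with y hy
      exact ⟨ht.1.trans hy.1.le, hy.2.le⟩
    obtain ⟨y, hy1, hy2⟩ := (h1.and h2).exists
    exact absurd (hmax hy2) (not_le.2 hy1)
  have hzero : deriv u t = 0 := by
    rcases ht.1.lt_or_eq with hlt | heq
    · exact (hmax.isLocalMax (Icc_mem_nhds hlt htT)).deriv_eq_zero
    · have hTpos : 0 ≤ deriv u T := by
        by_contra! hneg
        have h1 : ∀ᶠ y in 𝓝[<] T, u T < u y := by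
          have := (hu1 T).hasDerivAt.tendsto_slope.mono_left
            (nhdsWithin_mono T (fun y (hy : y < T) => hy.ne))
          filter_upwards [this.eventually (gt_mem_nhds hneg), self_mem_nhdsWithin] with y hy hty
          rw [slope_def_field] at hy
          have hty' : y - T < 0 := sub_neg.2 hty
          by_contra! hle
          have : 0 ≤ (u y - u T) / (y - T) := div_nonneg_of_nonpos (by linarith) hty'.le
          linarith
        have h2 : ∀ᶠ y in 𝓝[<] T, y ∈ Icc 0 T := by
          filter_upwards [Ioo_mem_nhdsLT hT] with y hy
          exact ⟨hy.1.le, hy.2.le⟩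
        obtain ⟨y, hy1, hy2⟩ := (h1.and h2).exists
        have h3 : u y ≤ u t := hmax hy2
        rw [← heq, hp] at h3
        linarith
      rw [← heq] at hright ⊢
      linarith
  have hpos := h t ht hut hzero
  -- the derivative is positive to the right of `t`
  obtain ⟨e, he, hball⟩ := Metric.eventually_nhds_iff.1 (hu3.continuousAt.eventually (lt_mem_nhds hpos))
  set b := min (t + e / 2) T with hb
  have htb : t < b := lt_min (by linarith) htT
  have hbT : b ≤ T := min_le_right _ _
  have hbe : b ≤ t + e / 2 := min_le_left _ _
  have hm1 : StrictMonoOn (deriv u) (Icc t b) := by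
    refine strictMonoOn_of_deriv_pos (convex_Icc _ _) hu2.continuous.continuousOn fun y hy => ?_
    rw [interior_Icc] at hy
    apply hball
    rw [Real.dist_eq, abs_of_pos (by linarith [hy.1])]
    linarith [hy.2]
  have hm2 : StrictMonoOn u (Icc t b) := by
    refine strictMonoOn_of_deriv_pos (convex_Icc _ _) hu.continuous.continuousOn fun y hy => ?_
    rw [interior_Icc] at hy
    have := hm1 ⟨le_rfl, htb.le⟩ ⟨hy.1.le, hy.2.le⟩ hy.1
    rwa [hzero] at this
  have h5 := hm2 ⟨le_rfl, htb.le⟩ ⟨htb.le, le_rfl⟩ htb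
  exact absurd (hmax (⟨ht.1.trans htb.le, hbT⟩ : b ∈ Icc 0 T)) (not_le.2 h5)

lemma nagumo_exists (T : ℝ) (φ : ℝ → ℝ) (hc : ContinuousOn φ (Ici 0))
    (hpos : ∀ s ∈ Ici (0:ℝ), 0 < φ s)
    (h_integ : (∫⁻ s in Ici (0:ℝ), ENNReal.ofReal (1 / φ s)) = ⊤) :
    ∃ N0 : ℝ, 0 < N0 ∧ ∀ N, N0 ≤ N → T < ∫ s in (0:ℝ)..N, 1 / φ s := by
  have hcont : ContinuousOn (fun s => 1 / φ s) (Ici 0) :=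
    continuousOn_const.div hc fun s hs => (hpos s hs).ne'
  have hii : ∀ a b, 0 ≤ a → a ≤ b → IntervalIntegrable (fun s => 1 / φ s) MeasureTheory.volume a b := by
    intro a b ha hab
    apply ContinuousOn.intervalIntegrable
    rw [uIcc_of_le hab]
    exact hcont.mono fun s hs => ha.trans hs.1
  have hmono : ∀ a b, 0 ≤ a → a ≤ b → ∫ s in (0:ℝ)..a, 1 / φ s ≤ ∫ s in (0:ℝ)..b, 1 / φ s := by
    intro a b ha hab
    rw [← intervalIntegral.integral_add_adjacent_intervals (hii 0 a le_rfl ha) (hii a b ha hab)]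
    have : 0 ≤ ∫ s in a..b, 1 / φ s := intervalIntegral.integral_nonneg hab fun s hs =>
      one_div_nonneg.2 (hpos s (ha.trans hs.1)).le
    linarith
  by_contra! hcon
  have hle : ∀ N, 0 < N → ∫ s in (0:ℝ)..N, 1 / φ s ≤ T := by
    intro N hN
    obtain ⟨N', h1, h2⟩ := hcon N hN
    exact (hmono N N' hN.le h1).trans h2
  have hI : MeasureTheory.IntegrableOn (fun s => 1 / φ s) (Ioi 0) := by
    refine MeasureTheory.integrableOn_Ioi_of_intervalIntegral_norm_bounded T 0
      (l := Filter.atTop) (b := fun n : ℝ => n) ?_ Filter.tendsto_id ?_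
    · intro n
      rcases le_or_gt 0 n with h | h
      · exact (intervalIntegrable_iff_integrableOn_Ioc_of_le h).1 (hii 0 n le_rfl h)
      · rw [Ioc_eq_empty (by linarith)]; simp
    · filter_upwards [Filter.eventually_gt_atTop 0] with n hn
      refine le_trans (le_of_eq ?_) (hle n hn)
      refine intervalIntegral.integral_congr fun s hs => ?_
      rw [uIcc_of_le hn.le] at hs
      exact Real.norm_of_nonneg (one_div_nonneg.2 (hpos s hs.1).le)
  have h2 : MeasureTheory.IntegrableOn (fun s => 1 / φ s) (Ici 0) :=
    (integrableOn_Ici_iff_integrableOn_Ioi (by simp)).2 hI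
  have h3 := MeasureTheory.Integrable.lintegral_lt_top h2
  rw [h_integ] at h3
  exact lt_irrefl _ h3

lemma nagumo_bound (T N : ℝ) (hT : 0 < T) (hN : 0 < N) (φ : ℝ → ℝ) (hc : ContinuousOn φ (Ici 0))
    (hpos : ∀ s ∈ Ici (0:ℝ), 0 < φ s) (hTN : T < ∫ s in (0:ℝ)..N, 1 / φ s)
    (z : ℝ → ℝ) (hz : ContDiff ℝ 2 z) (hz0 : z 0 = z T)
    (hb : ∀ t ∈ Icc 0 T, |deriv (deriv z) t| ≤ φ (min |deriv z t| N)) :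
    ∀ t ∈ Icc 0 T, |deriv z t| ≤ N := by
  let p : ℝ → ℝ := fun s => 1 / φ (min |s| N)
  have hmem : ∀ s, min |s| N ∈ Ici (0:ℝ) := fun s => le_min (abs_nonneg s) hN.le
  have hp : Continuous p := by
    refine continuous_const.div ?_ fun s => (hpos _ (hmem s)).ne'
    exact hc.comp_continuous (by fun_prop) hmem
  have hppos : ∀ s, 0 < p s := fun s => one_div_pos.2 (hpos _ (hmem s))
  let Φ : ℝ → ℝ := fun s => ∫ r in (0:ℝ)..s, p r
  have hΦ : ∀ s, HasDerivAt Φ (p s) s := fun s => (hp.integral_hasStrictDerivAt 0 s).hasDerivAt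
  have hΦm : StrictMono Φ := strictMono_of_deriv_pos fun s => by rw [(hΦ s).deriv]; exact hppos s
  have hΦ0 : Φ 0 = 0 := intervalIntegral.integral_same
  have hΦodd : Φ (-N) = - Φ N := by
    have h1 : ∫ r in (0:ℝ)..N, p (-r) = ∫ r in (-N)..(-0), p r :=
      intervalIntegral.integral_comp_neg p
    have h2 : ∀ r, p (-r) = p r := fun r => by simp [p]
    simp only [h2, neg_zero] at h1
    show ∫ r in (0:ℝ)..(-N), p r = - ∫ r in (0:ℝ)..N, p r
    rw [h1, intervalIntegral.integral_symm]
  have hΦN : T < Φ N := by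
    refine hTN.trans_le (le_of_eq ?_)
    refine intervalIntegral.integral_congr fun s hs => ?_
    rw [uIcc_of_le hN.le] at hs
    show 1 / φ s = 1 / φ (min |s| N)
    rw [abs_of_nonneg hs.1, min_eq_left hs.2]
  obtain ⟨t0, ht0, hz't0⟩ := exists_deriv_eq_zero hT hz.continuous.continuousOn hz0
  have hz2 : ContDiff ℝ 1 (deriv z) := by
    have : ContDiff ℝ (1 + 1) z := hz.of_le (by norm_num)
    exact (contDiff_succ_iff_deriv.1 this).2.2
  have hd : ∀ t, HasDerivAt (fun t => Φ (deriv z t)) (p (deriv z t) * deriv (deriv z) t) t :=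
    fun t => (hΦ _).comp t ((hz2.differentiable (by norm_num)) t).hasDerivAt
  intro t ht
  have hlip := (convex_Icc (0:ℝ) T).norm_image_sub_le_of_norm_hasDerivWithin_le
    (f := fun t => Φ (deriv z t)) (C := 1) (fun x _ => (hd x).hasDerivWithinAt)
    (fun x hx => by
      rw [norm_mul, Real.norm_of_nonneg (hppos _).le, Real.norm_eq_abs]
      show 1 / φ (min |deriv z x| N) * _ ≤ 1
      rw [one_div, inv_mul_le_one₀ (hpos _ (hmem _))]
      exact hb x hx) ⟨ht0.1.le, ht0.2.le⟩ ht
  rw [hz't0, hΦ0, sub_zero, one_mul, Real.norm_eq_abs, Real.norm_eq_abs] at hlip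
  have h1 : |t - t0| ≤ T := abs_le.2 ⟨by linarith [ht.1, ht0.2], by linarith [ht.2, ht0.1]⟩
  have h2 := abs_le.1 (hlip.trans h1)
  refine abs_le.2 ⟨?_, ?_⟩
  · refine (hΦm.lt_iff_lt.1 ?_).le
    rw [hΦodd]; linarith
  · refine (hΦm.lt_iff_lt.1 ?_).le
    linarith

end SecondOrder
section Final
open Set Topology

lemma supNorm_ge (T : ℝ) (a : ℝ → ℝ) (ha : Continuous a) (t : ℝ) (ht : t ∈ Icc 0 T) :
    |a t| ≤ supNorm T a := by
  refine le_csSup ?_ ⟨t, ht, rfl⟩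
  exact (isCompact_Icc.image ha.abs).bddAbove

lemma low_le_up (T : ℝ) (a b : ℝ → ℝ) (ha : Continuous a) (hb : Continuous b) (t : ℝ)
    (ht : t ∈ Icc 0 T) : lowShift T a t ≤ upShift T b t := by
  have h1 := abs_le.1 (supNorm_ge T a ha t ht)
  have h2 := abs_le.1 (supNorm_ge T b hb t ht)
  unfold lowShift upShift
  linarith

lemma trunc_eq (lo hi : ℝ → ℝ) (t x : ℝ) (h : lo t ≤ hi t) :
    trunc lo hi t x = max (lo t) (min x (hi t)) := by
  unfold trunc
  split_ifs with h1 h2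
  · rw [min_eq_right h1.le, max_eq_right h]
  · rw [min_eq_left (by linarith), max_eq_left h2.le]
  · rw [min_eq_left (by linarith), max_eq_right (by linarith)]

/-- Truncation of a derivative variable. -/
noncomputable def clipD (N x : ℝ) : ℝ := max (-N) (min x N)

lemma clipD_of_abs_le {N x : ℝ} (h : |x| ≤ N) : clipD N x = x := by
  have := abs_le.1 h
  unfold clipD
  rw [min_eq_left this.2, max_eq_right this.1]

lemma abs_clipD {N : ℝ} (hN : 0 < N) (x : ℝ) : |clipD N x| = min |x| N := by
  unfold clipD
  rcases le_total x 0 with hx | hx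
  · rw [min_eq_left (by linarith), abs_of_nonpos hx]
    rcases le_total (-N) x with h | h
    · rw [max_eq_right h, abs_of_nonpos hx, min_eq_left (by linarith)]
    · rw [max_eq_left h, abs_neg, abs_of_pos hN, min_eq_right (by linarith)]
  · rw [abs_of_nonneg hx]
    rcases le_total x N with h | h
    · rw [min_eq_left h, max_eq_right (by linarith), abs_of_nonneg hx]
    · rw [min_eq_right h, max_eq_right (by linarith), abs_of_pos hN]

lemma scalar_apriori (T N : ℝ) (hT : 0 < T) (hN : 0 < N) (φ : ℝ → ℝ)
    (hc : ContinuousOn φ (Ici 0))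
    (hpos : ∀ s ∈ Ici (0:ℝ), 0 < φ s) (hTN : T < ∫ s in (0:ℝ)..N, 1 / φ s)
    (α β z F : ℝ → ℝ) (hα : ContDiff ℝ 2 α) (hβ : ContDiff ℝ 2 β) (hz : ContDiff ℝ 2 z)
    (hz0 : z 0 = z T) (hz1 : deriv z 0 = deriv z T)
    (hα0 : α 0 = α T) (hα1 : deriv α T ≤ deriv α 0)
    (hβ0 : β 0 = β T) (hβ1 : deriv β 0 ≤ deriv β T)
    (hode : ∀ t ∈ Icc 0 T, deriv (deriv z) t
      = z t + (F t - trunc (lowShift T α) (upShift T β) t (z t)))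
    (hlo : ∀ t ∈ Icc 0 T, deriv z t = deriv α t → z t < lowShift T α t → F t ≤ deriv (deriv α) t)
    (hhi : ∀ t ∈ Icc 0 T, deriv z t = deriv β t → upShift T β t < z t → deriv (deriv β) t ≤ F t)
    (hF : ∀ t ∈ Icc 0 T, |F t| ≤ φ |clipD N (deriv z t)|) :
    ∀ t ∈ Icc 0 T, |deriv z t| ≤ N := by
  have D1 : ∀ u : ℝ → ℝ, ContDiff ℝ 2 u → ∀ t, DifferentiableAt ℝ u t := fun u hu =>
    hu.differentiable (by norm_num)
  have D2 : ∀ u : ℝ → ℝ, ContDiff ℝ 2 u → ∀ t, DifferentiableAt ℝ (deriv u) t := by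
    intro u hu
    have : ContDiff ℝ (1 + 1) u := hu.of_le (by norm_num)
    exact (contDiff_succ_iff_deriv.1 this).2.2.differentiable (by norm_num)
  have E1 : ∀ u v : ℝ → ℝ, ContDiff ℝ 2 u → ContDiff ℝ 2 v →
      deriv (fun t => u t - v t) = fun t => deriv u t - deriv v t := fun u v hu hv =>
    funext fun t => deriv_fun_sub (D1 u hu t) (D1 v hv t)
  have E2 : ∀ u v : ℝ → ℝ, ContDiff ℝ 2 u → ContDiff ℝ 2 v → ∀ t,
      deriv (deriv (fun t => u t - v t)) t = deriv (deriv u) t - deriv (deriv v) t := by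
    intro u v hu hv t
    rw [E1 u v hu hv]
    exact deriv_fun_sub (D2 u hu t) (D2 v hv t)
  have hup : ∀ t ∈ Icc 0 T, z t ≤ upShift T β t := by
    have := max_principle T hT (fun t => z t - β t) (hz.sub hβ) (supNorm T β)
      (by rw [hz0, hβ0]) (by rw [E1 z β hz hβ]; simp only; linarith) (by
        intro t ht h1 h2
        rw [E1 z β hz hβ] at h2
        rw [E2 z β hz hβ, hode t ht]
        have h3 : upShift T β t < z t := by unfold upShift; linarith
        have h4 := hhi t ht (by linarith) h3
        have h5 : trunc (lowShift T α) (upShift T β) t (z t) = upShift T β t := by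
          unfold trunc; rw [if_pos h3]
        rw [h5]; linarith)
    intro t ht
    have := this t ht
    unfold upShift; linarith
  have hdn : ∀ t ∈ Icc 0 T, lowShift T α t ≤ z t := by
    have := max_principle T hT (fun t => α t - z t) (hα.sub hz) (supNorm T α)
      (by rw [hz0, hα0]) (by rw [E1 α z hα hz]; simp only; linarith) (by
        intro t ht h1 h2
        rw [E1 α z hα hz] at h2
        rw [E2 α z hα hz, hode t ht]
        have h3 : z t < lowShift T α t := by unfold lowShift; linarith
        have h4 := hlo t ht (by linarith) h3
        have h5 : trunc (lowShift T α) (upShift T β) t (z t) = lowShift T α t := by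
          unfold trunc; rw [if_neg (not_lt.2 (hup t ht)), if_pos h3]
        rw [h5]; linarith)
    intro t ht
    have := this t ht
    unfold lowShift; linarith
  refine nagumo_bound T N hT hN φ hc hpos hTN z hz hz0 fun t ht => ?_
  have h5 : trunc (lowShift T α) (upShift T β) t (z t) = z t := by
    unfold trunc; rw [if_neg (not_lt.2 (hup t ht)), if_neg (not_lt.2 (hdn t ht))]
  rw [hode t ht, h5, ← abs_clipD hN]
  simpa using hF t ht

lemma deriv_range (T : ℝ) (a b : ℝ → ℝ) (ha : ContDiff ℝ 2 a) (t : ℝ) (ht : t ∈ Icc 0 T) :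
    (min (sInf (deriv a '' Icc 0 T)) (sInf (deriv b '' Icc 0 T)) ≤ deriv a t ∧
    deriv a t ≤ max (sSup (deriv a '' Icc 0 T)) (sSup (deriv b '' Icc 0 T))) := by
  have hK : IsCompact (deriv a '' Icc 0 T) :=
    isCompact_Icc.image (ha.continuous_deriv (by norm_num))
  exact ⟨(min_le_left _ _).trans (csInf_le hK.bddBelow ⟨t, ht, rfl⟩),
    (le_csSup hK.bddAbove ⟨t, ht, rfl⟩).trans (le_max_left _ _)⟩

lemma deriv_bdd (T : ℝ) (a : ℝ → ℝ) (ha : ContDiff ℝ 2 a) :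
    ∃ K, ∀ t ∈ Icc 0 T, |deriv a t| ≤ K := by
  obtain ⟨K, hK⟩ := (isCompact_Icc (a := (0:ℝ)) (b := T)).exists_bound_of_continuousOn
    (ha.continuous_deriv (by norm_num)).continuousOn
  exact ⟨K, hK⟩

lemma trunc_bdd (T : ℝ) (a b : ℝ → ℝ) (ha : Continuous a) (hb : Continuous b) :
    ∃ K, ∀ t ∈ Icc 0 T, ∀ x, |max (lowShift T a t) (min x (upShift T b t))| ≤ K := by
  refine ⟨2 * supNorm T a + 2 * supNorm T b, fun t ht x => ?_⟩
  have h1 := abs_le.1 (supNorm_ge T a ha t ht)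
  have h2 := abs_le.1 (supNorm_ge T b hb t ht)
  unfold lowShift upShift
  refine abs_le.2 ⟨?_, ?_⟩
  · exact le_trans (by linarith) (le_max_left _ _)
  · exact max_le (by linarith) ((min_le_right _ _).trans (by linarith))

lemma modified_cont (T : ℝ) (hT : 0 < T) (f : ℝ → ℝ → ℝ → ℝ → ℝ → ℝ)
    (hf : ContinuousOn (fun p : ℝ × ℝ × ℝ × ℝ × ℝ =>
      f p.1 p.2.1 p.2.2.1 p.2.2.2.1 p.2.2.2.2)
      (Set.Icc 0 T ×ˢ (Set.univ : Set (ℝ × ℝ × ℝ × ℝ))))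
    (N : ℝ) (l₁ u₁ l₂ u₂ : ℝ → ℝ) (hl₁ : Continuous l₁) (hu₁ : Continuous u₁)
    (hl₂ : Continuous l₂) (hu₂ : Continuous u₂) :
    Continuous (fun p : ℝ × ℝ × ℝ × ℝ × ℝ =>
      f (projIcc 0 T hT.le p.1)
        (max (l₁ (projIcc 0 T hT.le p.1)) (min p.2.1 (u₁ (projIcc 0 T hT.le p.1))))
        (max (l₂ (projIcc 0 T hT.le p.1)) (min p.2.2.1 (u₂ (projIcc 0 T hT.le p.1))))
        (clipD N p.2.2.2.1) (clipD N p.2.2.2.2)) := by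
  have hproj : Continuous (fun p : ℝ × ℝ × ℝ × ℝ × ℝ => ((projIcc 0 T hT.le p.1 : Icc 0 T) : ℝ)) :=
    continuous_subtype_val.comp ((continuous_projIcc (h := hT.le)).comp continuous_fst)
  have h2 : Continuous (fun p : ℝ × ℝ × ℝ × ℝ × ℝ =>
      (((projIcc 0 T hT.le p.1 : Icc 0 T) : ℝ),
        max (l₁ (projIcc 0 T hT.le p.1)) (min p.2.1 (u₁ (projIcc 0 T hT.le p.1))),
        max (l₂ (projIcc 0 T hT.le p.1)) (min p.2.2.1 (u₂ (projIcc 0 T hT.le p.1))),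
        clipD N p.2.2.2.1, clipD N p.2.2.2.2)) := by
    have a1 := hl₁.comp hproj
    have a2 := hu₁.comp hproj
    have a3 := hl₂.comp hproj
    have a4 := hu₂.comp hproj
    simp only [Function.comp_def] at a1 a2 a3 a4
    unfold clipD
    fun_prop
  exact hf.comp_continuous h2 fun p => ⟨(projIcc 0 T hT.le p.1).2, mem_univ _⟩

end Final

/-- Claim 3: under the hypotheses of the main theorem, the auxiliary problem
(AP) with `λ = μ = 1` together with the periodic boundary conditions has at
least one solution `(z, w) ∈ (C²[0,T])²`. -/
theorem stmt_6
    (T : ℝ) (hT : 0 < T)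
    (f g : ℝ → ℝ → ℝ → ℝ → ℝ → ℝ)
    (hf : ContinuousOn (fun p : ℝ × ℝ × ℝ × ℝ × ℝ =>
      f p.1 p.2.1 p.2.2.1 p.2.2.2.1 p.2.2.2.2)
      (Set.Icc 0 T ×ˢ (Set.univ : Set (ℝ × ℝ × ℝ × ℝ))))
    (hg : ContinuousOn (fun p : ℝ × ℝ × ℝ × ℝ × ℝ =>
      g p.1 p.2.1 p.2.2.1 p.2.2.2.1 p.2.2.2.2)
      (Set.Icc 0 T ×ˢ (Set.univ : Set (ℝ × ℝ × ℝ × ℝ))))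
    (α₁ α₂ β₁ β₂ : ℝ → ℝ)
    (hlow : IsLowerSolution T f g α₁ α₂)
    (hupp : IsUpperSolution T f g β₁ β₂)
    (φ ψ : ℝ → ℝ)
    (hNag : NagumoCondition T f g (lowShift T α₁) (upShift T β₁)
      (lowShift T α₂) (upShift T β₂) φ ψ)
    (hfmono : ∀ t ∈ Set.Icc 0 T, ∀ z₀ z₁ w₁ : ℝ,
      min (sInf (deriv α₁ '' Set.Icc 0 T)) (sInf (deriv β₁ '' Set.Icc 0 T)) ≤ z₁ →
      z₁ ≤ max (sSup (deriv α₁ '' Set.Icc 0 T)) (sSup (deriv β₁ '' Set.Icc 0 T)) →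
      ∀ w₀ w₀' : ℝ, w₀ ≤ w₀' → f t z₀ w₀' z₁ w₁ ≤ f t z₀ w₀ z₁ w₁)
    (hgmono : ∀ t ∈ Set.Icc 0 T, ∀ w₀ z₁ w₁ : ℝ,
      min (sInf (deriv α₂ '' Set.Icc 0 T)) (sInf (deriv β₂ '' Set.Icc 0 T)) ≤ w₁ →
      w₁ ≤ max (sSup (deriv α₂ '' Set.Icc 0 T)) (sSup (deriv β₂ '' Set.Icc 0 T)) →
      ∀ z₀ z₀' : ℝ, z₀ ≤ z₀' → g t z₀' w₀ z₁ w₁ ≤ g t z₀ w₀ z₁ w₁)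
    :
    ∃ z w : ℝ → ℝ, IsAPSolution T f g α₁ α₂ β₁ β₂ 1 1 z w ∧ PBC T z w := by
  obtain ⟨hα₁, hα₂, hlf, hlg, hα₁0, hα₂0, hα₁1, hα₂1⟩ := hlow
  obtain ⟨hβ₁, hβ₂, huf, hug, hβ₁0, hβ₂0, hβ₁1, hβ₂1⟩ := hupp
  obtain ⟨hφc, hψc, hφ, hψ, hφI, hψI, hbd⟩ := hNag
  obtain ⟨N₁, hN₁, hN₁'⟩ := nagumo_exists T φ hφc hφ hφI
  obtain ⟨N₂, hN₂, hN₂'⟩ := nagumo_exists T ψ hψc hψ hψI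
  obtain ⟨A₁, hA₁⟩ := deriv_bdd T α₁ hα₁
  obtain ⟨A₂, hA₂⟩ := deriv_bdd T α₂ hα₂
  obtain ⟨B₁, hB₁⟩ := deriv_bdd T β₁ hβ₁
  obtain ⟨B₂, hB₂⟩ := deriv_bdd T β₂ hβ₂
  obtain ⟨N, hN1, hN2, hNA₁, hNA₂, hNB₁, hNB₂⟩ : ∃ N, N₁ ≤ N ∧ N₂ ≤ N ∧ A₁ ≤ N ∧ A₂ ≤ N ∧
      B₁ ≤ N ∧ B₂ ≤ N := by
    refine ⟨max N₁ (max N₂ (max A₁ (max A₂ (max B₁ B₂)))), ?_, ?_, ?_, ?_, ?_, ?_⟩ <;> simp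
  have hN : 0 < N := hN₁.trans_le hN1
  obtain ⟨K₁, hK₁⟩ := trunc_bdd T α₁ β₁ hα₁.continuous hβ₁.continuous
  obtain ⟨K₂, hK₂⟩ := trunc_bdd T α₂ β₂ hα₂.continuous hβ₂.continuous
  have hlu₁ := low_le_up T α₁ β₁ hα₁.continuous hβ₁.continuous
  have hlu₂ := low_le_up T α₂ β₂ hα₂.continuous hβ₂.continuous
  have cl₁ : Continuous (lowShift T α₁) := hα₁.continuous.sub continuous_const
  have cl₂ : Continuous (lowShift T α₂) := hα₂.continuous.sub continuous_const
  have cu₁ : Continuous (upShift T β₁) := hβ₁.continuous.add continuous_const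
  have cu₂ : Continuous (upShift T β₂) := hβ₂.continuous.add continuous_const
  obtain ⟨F₁, hF₁⟩ := (isCompact_Icc (a := (0:ℝ)) (b := N)).exists_bound_of_continuousOn
    (hφc.mono fun s hs => hs.1)
  obtain ⟨F₂, hF₂⟩ := (isCompact_Icc (a := (0:ℝ)) (b := N)).exists_bound_of_continuousOn
    (hψc.mono fun s hs => hs.1)
  have hclip : ∀ x, |clipD N x| ∈ Set.Icc 0 N := fun x =>
    ⟨abs_nonneg _, by rw [abs_clipD hN]; exact min_le_right _ _⟩
  let δ₁ : ℝ → ℝ → ℝ := fun t x => max (lowShift T α₁ t) (min x (upShift T β₁ t))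
  let δ₂ : ℝ → ℝ → ℝ := fun t x => max (lowShift T α₂ t) (min x (upShift T β₂ t))
  have hδ₁l : ∀ t x, lowShift T α₁ t ≤ δ₁ t x := fun t x => le_max_left _ _
  have hδ₂l : ∀ t x, lowShift T α₂ t ≤ δ₂ t x := fun t x => le_max_left _ _
  have hδ₁u : ∀ t ∈ Set.Icc 0 T, ∀ x, δ₁ t x ≤ upShift T β₁ t := fun t ht x =>
    max_le (hlu₁ t ht) (min_le_right _ _)
  have hδ₂u : ∀ t ∈ Set.Icc 0 T, ∀ x, δ₂ t x ≤ upShift T β₂ t := fun t ht x =>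
    max_le (hlu₂ t ht) (min_le_right _ _)
  have hbd' : ∀ t ∈ Set.Icc 0 T, ∀ a b c d,
      |f t (δ₁ t a) (δ₂ t b) (clipD N c) (clipD N d)| ≤ φ |clipD N c| ∧
      |g t (δ₁ t a) (δ₂ t b) (clipD N c) (clipD N d)| ≤ ψ |clipD N d| := fun t ht a b c d =>
    hbd t ht _ _ _ _ (hδ₁l t a) (hδ₁u t ht a) (hδ₂l t b) (hδ₂u t ht b)
  have hM1 : F₁ + K₁ ≤ max (F₁ + K₁) (F₂ + K₂) := le_max_left _ _
  have hM2 : F₂ + K₂ ≤ max (F₁ + K₁) (F₂ + K₂) := le_max_right _ _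
  let π : ℝ → ℝ := fun t => (Set.projIcc 0 T hT.le t : Set.Icc 0 T)
  have hπ : ∀ t, π t ∈ Set.Icc 0 T := fun t => (Set.projIcc 0 T hT.le t).2
  have hπ' : ∀ t ∈ Set.Icc 0 T, π t = t := fun t ht => by
    simp only [π, Set.projIcc_of_mem hT.le ht]
  have hπc : Continuous (fun p : ℝ × ℝ × ℝ × ℝ × ℝ => π p.1) :=
    continuous_subtype_val.comp ((continuous_projIcc (h := hT.le)).comp continuous_fst)
  obtain ⟨z, w, hz, hw, hzo, hwo, hz0, hz1, hw0, hw1⟩ := second_order_system T hT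
    (fun t a b c d => f (π t) (δ₁ (π t) a) (δ₂ (π t) b) (clipD N c) (clipD N d) - δ₁ (π t) a)
    (fun t a b c d => g (π t) (δ₁ (π t) a) (δ₂ (π t) b) (clipD N c) (clipD N d) - δ₂ (π t) b)
    (by
      refine (modified_cont T hT f hf N _ _ _ _ cl₁ cu₁ cl₂ cu₂).sub ?_
      have a1 := cl₁.comp hπc
      have a2 := cu₁.comp hπc
      exact a1.max (continuous_snd.fst.min a2))
    (by
      refine (modified_cont T hT g hg N _ _ _ _ cl₁ cu₁ cl₂ cu₂).sub ?_
      have a1 := cl₂.comp hπc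
      have a2 := cu₂.comp hπc
      exact a1.max (continuous_snd.snd.fst.min a2))
    (max (F₁ + K₁) (F₂ + K₂))
    (by
      intro t a b c d
      refine le_trans ((abs_sub _ _).trans (add_le_add ?_ (hK₁ _ (hπ t) a))) hM1
      exact (hbd' _ (hπ t) a b c d).1.trans ((le_abs_self _).trans (hF₁ _ (hclip c))))
    (by
      intro t a b c d
      refine le_trans ((abs_sub _ _).trans (add_le_add ?_ (hK₂ _ (hπ t) b))) hM2
      exact (hbd' _ (hπ t) a b c d).2.trans ((le_abs_self _).trans (hF₂ _ (hclip d))))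
  have ht₁ : ∀ t ∈ Set.Icc 0 T, ∀ x, trunc (lowShift T α₁) (upShift T β₁) t x = δ₁ t x :=
    fun t ht x => trunc_eq _ _ t x (hlu₁ t ht)
  have ht₂ : ∀ t ∈ Set.Icc 0 T, ∀ x, trunc (lowShift T α₂) (upShift T β₂) t x = δ₂ t x :=
    fun t ht x => trunc_eq _ _ t x (hlu₂ t ht)
  have e1l : ∀ t ∈ Set.Icc 0 T, ∀ x, x < lowShift T α₁ t → δ₁ t x = lowShift T α₁ t :=
    fun t ht x hx => max_eq_left ((min_le_left _ _).trans hx.le)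
  have e2l : ∀ t ∈ Set.Icc 0 T, ∀ x, x < lowShift T α₂ t → δ₂ t x = lowShift T α₂ t :=
    fun t ht x hx => max_eq_left ((min_le_left _ _).trans hx.le)
  have e1u : ∀ t ∈ Set.Icc 0 T, ∀ x, upShift T β₁ t < x → δ₁ t x = upShift T β₁ t :=
    fun t ht x hx => by
      simp only [δ₁]; rw [min_eq_right hx.le, max_eq_right (hlu₁ t ht)]
  have e2u : ∀ t ∈ Set.Icc 0 T, ∀ x, upShift T β₂ t < x → δ₂ t x = upShift T β₂ t :=
    fun t ht x hx => by
      simp only [δ₂]; rw [min_eq_right hx.le, max_eq_right (hlu₂ t ht)]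
  have hz' : ∀ t ∈ Set.Icc 0 T, |deriv z t| ≤ N := by
    refine scalar_apriori T N hT hN φ hφc hφ (hN₁' N hN1) α₁ β₁ z
      (fun t => f t (δ₁ t (z t)) (δ₂ t (w t)) (clipD N (deriv z t)) (clipD N (deriv w t)))
      hα₁ hβ₁ hz hz0 hz1 hα₁0 hα₁1 hβ₁0 hβ₁1 ?_ ?_ ?_ ?_
    · intro t ht
      have h1 := hzo t ht
      rw [hπ' t ht] at h1
      rw [ht₁ t ht]
      exact h1
    · intro t ht hd hlt
      simp only [e1l t ht _ hlt, hd, clipD_of_abs_le ((hA₁ t ht).trans hNA₁)]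
      have hr := deriv_range T α₁ β₁ hα₁ t ht
      exact (hfmono t ht _ _ _ hr.1 hr.2 _ _ (hδ₂l t (w t))).trans (hlf t ht _)
    · intro t ht hd hlt
      simp only [e1u t ht _ hlt, hd, clipD_of_abs_le ((hB₁ t ht).trans hNB₁)]
      have hr := deriv_range T β₁ α₁ hβ₁ t ht
      rw [min_comm, max_comm] at hr
      exact (huf t ht _).trans (hfmono t ht _ _ _ hr.1 hr.2 _ _ (hδ₂u t ht (w t)))
    · intro t ht
      exact (hbd' t ht _ _ _ _).1
  have hw' : ∀ t ∈ Set.Icc 0 T, |deriv w t| ≤ N := by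
    refine scalar_apriori T N hT hN ψ hψc hψ (hN₂' N hN2) α₂ β₂ w
      (fun t => g t (δ₁ t (z t)) (δ₂ t (w t)) (clipD N (deriv z t)) (clipD N (deriv w t)))
      hα₂ hβ₂ hw hw0 hw1 hα₂0 hα₂1 hβ₂0 hβ₂1 ?_ ?_ ?_ ?_
    · intro t ht
      have h1 := hwo t ht
      rw [hπ' t ht] at h1
      rw [ht₂ t ht]
      exact h1
    · intro t ht hd hlt
      simp only [e2l t ht _ hlt, hd, clipD_of_abs_le ((hA₂ t ht).trans hNA₂)]
      have hr := deriv_range T α₂ β₂ hα₂ t ht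
      exact (hgmono t ht _ _ _ hr.1 hr.2 _ _ (hδ₁l t (z t))).trans (hlg t ht _)
    · intro t ht hd hlt
      simp only [e2u t ht _ hlt, hd, clipD_of_abs_le ((hB₂ t ht).trans hNB₂)]
      have hr := deriv_range T β₂ α₂ hβ₂ t ht
      rw [min_comm, max_comm] at hr
      exact (hug t ht _).trans (hgmono t ht _ _ _ hr.1 hr.2 _ _ (hδ₁u t ht (z t)))
    · intro t ht
      exact (hbd' t ht _ _ _ _).2
  refine ⟨z, w, ⟨hz, hw, ?_, ?_⟩, hz0, hz1, hw0, hw1⟩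
  · intro t ht
    have h1 := hzo t ht
    rw [hπ' t ht, clipD_of_abs_le (hz' t ht), clipD_of_abs_le (hw' t ht)] at h1
    rw [ht₁ t ht, ht₂ t ht, h1]; ring
  · intro t ht
    have h1 := hwo t ht
    rw [hπ' t ht, clipD_of_abs_le (hz' t ht), clipD_of_abs_le (hw' t ht)] at h1
    rw [ht₁ t ht, ht₂ t ht, h1]; ring
end
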